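/- arXiv:0805.1679 — 2 statements merged into one kernel-verified Lean document; each statement's English description precedes it below -/
import Mathlib

section
/- Let U ⊆ ℝⁿ be open, let π be a Poisson matrix on U, let x⁰ ∈ U, and let p_1,…,p_r: U → ℝ be smooth functions with p_i(x⁰) = 0 and {p_i,p_j} = 0 on U for all i,j, such that the vectors X_{p_1}(x⁰),…,X_{p_r}(x⁰) ∈ ℝⁿ are linearly independent. Then there exist an open set V with x⁰ ∈ V ⊆ U and smooth functions q_1,…,q_r, z_1,…,z_{n−2r}: V → ℝ such that: (1) the map Φ := (p_1,q_1,…,p_r,q_r,z_1,…,z_{n−2r}) is a diffeomorphism from V onto an open subset of ℝⁿ with Φ(x⁰) = 0; (2) on V one has {q_i,p_j} = δ_{ij}, {q_i,q_j} = 0, {q_i,z_k} = 0, {p_i,z_k} = 0 for all i,j,k, and there exist smooth functions g_{kl} on a neighborhood of 0 in ℝ^{n−2r} with {z_k,z_l}(x) = g_{kl}(z_1(x),…,z_{n−2r}(x)) for all x ∈ V. Moreover, the rank of the matrix π(x⁰) equals 2r if and only if g_{kl}(0) = 0 for all k,l. -/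
/-- Partial derivative of `f : ℝⁿ → ℝ` in the `i`-th coordinate direction. -/
noncomputable def pd {n : ℕ} (i : Fin n) (f : (Fin n → ℝ) → ℝ) (x : Fin n → ℝ) : ℝ :=
  fderiv ℝ f x (Pi.single i 1)

/-- A smooth antisymmetric matrix field satisfying the Jacobi identity on `U`. -/
def IsPoissonMatrix {n : ℕ} (P : (Fin n → ℝ) → Matrix (Fin n) (Fin n) ℝ)
    (U : Set (Fin n → ℝ)) : Prop :=
  (∀ i j, ContDiffOn ℝ (⊤ : ℕ∞) (fun x => P x i j) U) ∧
  (∀ x ∈ U, ∀ i j, P x i j = -P x j i) ∧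
  (∀ x ∈ U, ∀ i j k, ∑ l, (P x l k * pd l (fun y => P y i j) x
      + P x l i * pd l (fun y => P y j k) x
      + P x l j * pd l (fun y => P y k i) x) = 0)

/-- The Poisson bracket `{f,g} = Σ_{i,j} π^{ij} ∂f/∂x_i ∂g/∂x_j`. -/
noncomputable def pbrak {n : ℕ} (P : (Fin n → ℝ) → Matrix (Fin n) (Fin n) ℝ)
    (f g : (Fin n → ℝ) → ℝ) (x : Fin n → ℝ) : ℝ :=
  ∑ i, ∑ j, P x i j * pd i f x * pd j g x

/-- The Hamiltonian vector field `X_f`, with components `X_f^i = Σ_j π^{ij} ∂f/∂x_j`. -/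
noncomputable def ham {n : ℕ} (P : (Fin n → ℝ) → Matrix (Fin n) (Fin n) ℝ)
    (f : (Fin n → ℝ) → ℝ) (x : Fin n → ℝ) : Fin n → ℝ :=
  fun i => ∑ j, P x i j * pd j f x

open scoped ContDiff

/-- Smooth inverse function theorem on an open set. -/
theorem exists_smooth_openPartialHomeomorph {E F : Type*} [NormedAddCommGroup E] [NormedSpace ℝ E]
    [CompleteSpace E] [NormedAddCommGroup F] [NormedSpace ℝ F] {f : E → F} {s : Set E}
    (hs : IsOpen s) (hf : ContDiffOn ℝ ∞ f s) {x₀ : E} (hx₀ : x₀ ∈ s) (f' : E ≃L[ℝ] F)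
    (hf' : HasFDerivAt f (f' : E →L[ℝ] F) x₀) :
    ∃ e : OpenPartialHomeomorph E F, (e : E → F) = f ∧ x₀ ∈ e.source ∧ e.source ⊆ s ∧
      ContDiffOn ℝ ∞ e.symm e.target ∧
      ∀ x ∈ e.source, ∀ v, fderiv ℝ e.symm (f x) (fderiv ℝ f x v) = v := by
  have hn : (∞ : WithTop ℕ∞) ≠ 0 := by simp
  have hfx : ∀ x ∈ s, ContDiffAt ℝ ∞ f x := fun x hx => hf.contDiffAt (hs.mem_nhds hx)
  let e₀ := (hfx x₀ hx₀).toOpenPartialHomeomorph f hf' hn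
  have hcont : ContinuousOn (fderiv ℝ f) s := hf.continuousOn_fderiv_of_isOpen hs (by simp)
  let t : Set E := s ∩ fderiv ℝ f ⁻¹' Set.range ((↑) : (E ≃L[ℝ] F) → E →L[ℝ] F)
  have ht : IsOpen t := hcont.isOpen_inter_preimage hs (ContinuousLinearEquiv.isOpen)
  let e := e₀.restrOpen t ht
  have hesource : e.source = e₀.source ∩ t := e₀.restrOpen_source t ht
  have he : (e : E → F) = f := rfl
  have hsymm : ContDiffOn ℝ ∞ e.symm e.target := by
    intro y hy
    have hx : e.symm y ∈ e.source := e.map_target hy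
    rw [hesource] at hx
    obtain ⟨-, hxs, A, hA⟩ := hx
    refine (e.contDiffAt_symm (f₀' := A) hy ?_ ?_).contDiffWithinAt
    · rw [he, hA]
      exact ((hfx _ hxs).differentiableAt hn).hasFDerivAt
    · rw [he]; exact hfx _ hxs
  refine ⟨e, he, ?_, ?_, hsymm, ?_⟩
  · rw [hesource]
    exact ⟨(hfx x₀ hx₀).mem_toOpenPartialHomeomorph_source hf' hn, hx₀, f', hf'.fderiv.symm⟩
  · rw [hesource]; exact fun x hx => hx.2.1
  · intro x hx v
    have hxs : x ∈ s := by rw [hesource] at hx; exact hx.2.1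
    have hfx' := ((hfx x hxs).differentiableAt hn).hasFDerivAt
    have hy : f x ∈ e.target := e.map_source hx
    have hg := ((hsymm.contDiffAt (e.open_target.mem_nhds hy)).differentiableAt hn).hasFDerivAt
    have hcomp := hg.comp x hfx'
    have hid : HasFDerivAt (e.symm ∘ f) (ContinuousLinearMap.id ℝ E) x := by
      refine (hasFDerivAt_id x).congr_of_eventuallyEq ?_
      filter_upwards [e.open_source.mem_nhds hx] with z hz
      exact e.left_inv hz
    exact congrArg (fun L : E →L[ℝ] E => L v) (hcomp.unique hid)

section Superposition

variable {K : Type*} [TopologicalSpace K] [CompactSpace K]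

/-- Pointwise application of a family of operators to a family of vectors, as a continuous linear
map of the family of operators. -/
noncomputable def ContinuousMap.pointwiseApply (K : Type*) [TopologicalSpace K] [CompactSpace K]
    (E F : Type*) [NormedAddCommGroup E] [NormedSpace ℝ E]
    [NormedAddCommGroup F] [NormedSpace ℝ F] :
    C(K, E →L[ℝ] F) →L[ℝ] C(K, E) →L[ℝ] C(K, F) :=
  LinearMap.mkContinuous₂
    (LinearMap.mk₂ ℝ (fun (A : C(K, E →L[ℝ] F)) (h : C(K, E)) =>
        (⟨fun τ => A τ (h τ), A.continuous.clm_apply h.continuous⟩ : C(K, F)))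
      (fun A B h => by ext; simp) (fun c A h => by ext; simp)
      (fun A h k => by ext; simp) (fun c A h => by ext; simp)) 1 (by
    intro A h
    refine (ContinuousMap.norm_le _ (by positivity)).2 fun τ => ?_
    rw [one_mul]
    exact ((A τ).le_opNorm _).trans
      (mul_le_mul (A.norm_coe_le_norm τ) (h.norm_coe_le_norm τ) (norm_nonneg _)
        ((norm_nonneg _).trans (A.norm_coe_le_norm τ))))

@[simp]
theorem ContinuousMap.pointwiseApply_apply {E F : Type*} [NormedAddCommGroup E] [NormedSpace ℝ E]
    [NormedAddCommGroup F] [NormedSpace ℝ F] (A : C(K, E →L[ℝ] F)) (h : C(K, E)) (τ : K) :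
    ContinuousMap.pointwiseApply K E F A h τ = A τ (h τ) := rfl

theorem ContinuousMap.exists_dist_comp_lt {X Y : Type*} [PseudoMetricSpace X]
    [PseudoMetricSpace Y] (g : C(X, Y)) (γ : C(K, X)) {ε : ℝ} (hε : 0 < ε) :
    ∃ δ > 0, ∀ η : C(K, X), dist η γ < δ → dist (g.comp η) (g.comp γ) < ε := by
  obtain ⟨δ, hδ, h⟩ := Metric.tendsto_nhds_nhds.1 ((ContinuousMap.continuous_postcomp g).tendsto γ)
    ε hε
  exact ⟨δ, hδ, fun η hη => h hη⟩

theorem ContinuousMap.hasFDerivAt_comp_left {E F : Type*} [NormedAddCommGroup E] [NormedSpace ℝ E]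
    [NormedAddCommGroup F] [NormedSpace ℝ F] (f : C(E, F)) (f' : C(E, E →L[ℝ] F))
    (hf : ∀ x, HasFDerivAt f (f' x) x) (γ : C(K, E)) :
    HasFDerivAt (fun γ : C(K, E) => f.comp γ)
      (ContinuousMap.pointwiseApply K E F (f'.comp γ)) γ := by
  rw [hasFDerivAt_iff_isLittleO_nhds_zero, Asymptotics.isLittleO_iff]
  intro ε hε
  obtain ⟨δ, hδ, hball⟩ := ContinuousMap.exists_dist_comp_lt f' γ hε
  filter_upwards [Metric.ball_mem_nhds (0 : C(K, E)) hδ] with h hh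
  have hh' : ‖h‖ < δ := by simpa using hh
  refine (ContinuousMap.norm_le _ (by positivity)).2 fun τ => ?_
  have key : ∀ ξ ∈ Metric.ball (γ τ) δ, ‖f' ξ - f' (γ τ)‖ ≤ ε := by
    intro ξ hξ
    have h1 : dist (γ + ContinuousMap.const K (ξ - γ τ)) γ < δ := by
      rw [dist_eq_norm, add_sub_cancel_left]
      refine (ContinuousMap.norm_lt_iff _ hδ).2 fun σ => ?_
      simpa [dist_eq_norm] using hξ
    have h2 := ContinuousMap.dist_apply_le_dist (f := f'.comp (γ + ContinuousMap.const K (ξ - γ τ)))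
      (g := f'.comp γ) τ
    have h3 := h2.trans (hball _ h1).le
    simpa [dist_eq_norm] using h3
  have hle : ‖h τ‖ ≤ ‖h‖ := h.norm_coe_le_norm τ
  have hmem : γ τ + h τ ∈ Metric.ball (γ τ) δ := by
    simpa using hle.trans_lt hh'
  have := (convex_ball (γ τ) δ).norm_image_sub_le_of_norm_hasFDerivWithin_le' (f := f)
    (f' := f') (φ := f' (γ τ)) (fun x _ => (hf x).hasFDerivWithinAt) key
    (Metric.mem_ball_self hδ) hmem
  simp only [add_sub_cancel_left] at this
  simpa using this.trans (mul_le_mul_of_nonneg_left hle hε.le)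

universe u

theorem ContinuousMap.contDiff_comp_left_nat (m : ℕ) :
    ∀ {E F : Type u} [NormedAddCommGroup E] [NormedSpace ℝ E]
    [NormedAddCommGroup F] [NormedSpace ℝ F] (f : C(E, F)), ContDiff ℝ m f →
    ContDiff ℝ m (fun γ : C(K, E) => f.comp γ) := by
  induction m with
  | zero =>
    intro E F _ _ _ _ f _
    exact contDiff_zero.2 (ContinuousMap.continuous_postcomp f)
  | succ m ih =>
    intro E F _ _ _ _ f hf
    have hf' : ContDiff ℝ m (fderiv ℝ f) := hf.fderiv_right (by norm_cast)
    have hd : Differentiable ℝ f := hf.differentiable (by simp)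
    refine (contDiff_succ_iff_hasFDerivAt (n := m)).2
      ⟨_, ?_, fun γ => ContinuousMap.hasFDerivAt_comp_left f ⟨fderiv ℝ f, hf'.continuous⟩
        (fun x => (hd x).hasFDerivAt) γ⟩
    exact (ContinuousMap.pointwiseApply K E F).contDiff.comp (ih ⟨fderiv ℝ f, hf'.continuous⟩ hf')

/-- Composition with a smooth map is a smooth operation on spaces of continuous maps. -/
theorem ContinuousMap.contDiff_comp_left {E F : Type u} [NormedAddCommGroup E] [NormedSpace ℝ E]
    [NormedAddCommGroup F] [NormedSpace ℝ F] (f : C(E, F)) (hf : ContDiff ℝ ∞ f) :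
    ContDiff ℝ ∞ (fun γ : C(K, E) => f.comp γ) :=
  contDiff_infty.2 fun m => ContinuousMap.contDiff_comp_left_nat m f (contDiff_infty.1 hf m)

end Superposition

section Primitive

open unitInterval intervalIntegral

variable {E : Type*} [NormedAddCommGroup E] [NormedSpace ℝ E]

/-- The primitive vanishing at `0` of a continuous curve on the unit interval, as a continuous
linear operator. -/
noncomputable def curvePrimitive (E : Type*) [NormedAddCommGroup E] [NormedSpace ℝ E] :
    C(I, E) →L[ℝ] C(I, E) :=
  LinearMap.mkContinuous
    { toFun := fun u =>
        ⟨fun τ => ∫ ρ in (0 : ℝ)..τ, u (Set.projIcc 0 1 zero_le_one ρ),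
          (continuous_primitive (fun _ _ =>
            (u.continuous.comp continuous_projIcc).intervalIntegrable _ _) 0).comp
              continuous_subtype_val⟩
      map_add' := fun u v => by
        ext τ
        exact integral_add ((u.continuous.comp continuous_projIcc).intervalIntegrable _ _)
          ((v.continuous.comp continuous_projIcc).intervalIntegrable _ _)
      map_smul' := fun c u => by
        ext τ
        exact integral_smul c _ } 1 (by
    intro u
    refine (ContinuousMap.norm_le _ (by positivity)).2 fun τ => ?_
    have := norm_integral_le_of_norm_le_const (a := (0 : ℝ)) (b := τ) (C := ‖u‖)
      (f := fun ρ => u (Set.projIcc 0 1 zero_le_one ρ)) fun ρ _ => u.norm_coe_le_norm _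
    refine this.trans ?_
    rw [sub_zero, abs_of_nonneg τ.2.1, one_mul]
    exact mul_le_of_le_one_right (norm_nonneg _) τ.2.2)

theorem curvePrimitive_apply (u : C(I, E)) (τ : I) :
    curvePrimitive E u τ = ∫ ρ in (0 : ℝ)..τ, u (Set.projIcc 0 1 zero_le_one ρ) := rfl

theorem hasDerivAt_curvePrimitive [CompleteSpace E] (u : C(I, E)) {τ : ℝ}
    (hτ : τ ∈ Set.Ioo (0 : ℝ) 1) :
    HasDerivAt (fun ρ => curvePrimitive E u (Set.projIcc 0 1 zero_le_one ρ))
      (u (Set.projIcc 0 1 zero_le_one τ)) τ := by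
  have hc : Continuous fun ρ : ℝ => u (Set.projIcc 0 1 zero_le_one ρ) :=
    u.continuous.comp continuous_projIcc
  refine (hc.integral_hasStrictDerivAt 0 τ).hasDerivAt.congr_of_eventuallyEq ?_
  filter_upwards [Ioo_mem_nhds hτ.1 hτ.2] with ρ hρ
  rw [curvePrimitive_apply, Set.projIcc_of_mem zero_le_one (Set.Ioo_subset_Icc_self hρ)]

theorem eq_curvePrimitive [CompleteSpace E] (w u : C(I, E)) (h0 : w 0 = 0)
    (h : ∀ τ ∈ Set.Ioo (0 : ℝ) 1, HasDerivAt (fun ρ => w (Set.projIcc 0 1 zero_le_one ρ))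
      (u (Set.projIcc 0 1 zero_le_one τ)) τ) : w = curvePrimitive E u := by
  ext τ
  have hw : Continuous fun ρ : ℝ => w (Set.projIcc 0 1 zero_le_one ρ) :=
    w.continuous.comp continuous_projIcc
  have hu : Continuous fun ρ : ℝ => u (Set.projIcc 0 1 zero_le_one ρ) :=
    u.continuous.comp continuous_projIcc
  rw [curvePrimitive_apply, integral_eq_sub_of_hasDerivAt_of_le τ.2.1 hw.continuousOn
    (fun ρ hρ => h ρ ⟨hρ.1, hρ.2.trans_le τ.2.2⟩) (hu.intervalIntegrable _ _)]
  have h1 : Set.projIcc (0 : ℝ) 1 zero_le_one 0 = 0 := Set.projIcc_left zero_le_one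
  rw [Set.projIcc_val, h1, h0, sub_zero]

/-- If `γ` is an integral curve of the time-dependent velocity `u`, then `τ ↦ τ • g (γ τ)` is the
primitive of its derivative. -/
theorem smul_comp_eq_curvePrimitive [CompleteSpace E] {γ u : C(I, E)} {s : E}
    (hγ : γ = ContinuousMap.const I s + curvePrimitive E u) {g : C(E, E)} {g' : C(E, E →L[ℝ] E)}
    (hg : ∀ x, HasFDerivAt g (g' x) x) {w w' : C(I, E)} (hw : ∀ τ : I, w τ = (τ : ℝ) • g (γ τ))
    (hw' : ∀ τ : I, w' τ = g (γ τ) + (τ : ℝ) • g' (γ τ) (u τ)) :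
    w = curvePrimitive E w' := by
  refine eq_curvePrimitive _ _ (by simp [hw]) fun τ hτ => ?_
  have hp : Set.projIcc (0 : ℝ) 1 zero_le_one τ = ⟨τ, Set.Ioo_subset_Icc_self hτ⟩ :=
    Set.projIcc_of_mem zero_le_one (Set.Ioo_subset_Icc_self hτ)
  have hγ' : HasDerivAt (fun ρ => γ (Set.projIcc 0 1 zero_le_one ρ))
      (u (Set.projIcc 0 1 zero_le_one τ)) τ := by
    have := (hasDerivAt_curvePrimitive u hτ).const_add s
    rw [hγ]
    exact this
  have h1 := (hasDerivAt_id τ).smul ((hg _).comp_hasDerivAt τ hγ')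
  have h2 : HasDerivAt (fun ρ => w (Set.projIcc 0 1 zero_le_one ρ))
      (τ • g' (γ (Set.projIcc 0 1 zero_le_one τ)) (u (Set.projIcc 0 1 zero_le_one τ)) +
        (1 : ℝ) • g (γ (Set.projIcc 0 1 zero_le_one τ))) τ := by
    refine h1.congr_of_eventuallyEq ?_
    filter_upwards [Ioo_mem_nhds hτ.1 hτ.2] with ρ hρ
    rw [hw]
    simp [Set.projIcc_of_mem zero_le_one (Set.Ioo_subset_Icc_self hρ)]
  convert h2 using 1
  rw [hw', hp, one_smul, add_comm]

end Primitive

section Flow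

open unitInterval

universe u

variable {ι : Type*} [Fintype ι] {E : Type u} [NormedAddCommGroup E] [NormedSpace ℝ E]

/-- The map `(t, γ) ↦ (t, γ - ∫ ∑ tᵢ vᵢ(γ))`, whose value is `(t, const s)` exactly when `γ` is
the integral curve of `∑ tᵢ vᵢ` starting at `s`. -/
noncomputable def integralEquationMap (v : ι → C(E, E)) (q : (ι → ℝ) × C(I, E)) :
    (ι → ℝ) × C(I, E) :=
  (q.1, q.2 - ∑ i, q.1 i • curvePrimitive E ((v i).comp q.2))

theorem contDiff_integralEquationMap {v : ι → C(E, E)} (hv : ∀ i, ContDiff ℝ ∞ (v i)) :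
    ContDiff ℝ ∞ (integralEquationMap v) := by
  refine contDiff_fst.prodMk (contDiff_snd.sub (ContDiff.sum fun i _ => ?_))
  exact ((contDiff_apply ℝ ℝ i).comp contDiff_fst).smul ((curvePrimitive E).contDiff.comp
    ((ContinuousMap.contDiff_comp_left (v i) (hv i)).comp contDiff_snd))

theorem fderiv_integralEquationMap {v : ι → C(E, E)} {v' : ι → C(E, E →L[ℝ] E)}
    (hv : ∀ i x, HasFDerivAt (v i) (v' i x) x) (q : (ι → ℝ) × C(I, E)) (a : ι → ℝ) (w : C(I, E)) :
    fderiv ℝ (integralEquationMap v) q (a, w) =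
      (a, w - ∑ i, (q.1 i • curvePrimitive E
        (ContinuousMap.pointwiseApply I E E ((v' i).comp q.2) w)
          + a i • curvePrimitive E ((v i).comp q.2))) := by
  have h1 : ∀ i, HasFDerivAt (fun q : (ι → ℝ) × C(I, E) => curvePrimitive E ((v i).comp q.2))
      (curvePrimitive E ∘L ContinuousMap.pointwiseApply I E E ((v' i).comp q.2) ∘L
        ContinuousLinearMap.snd ℝ (ι → ℝ) C(I, E)) q := fun i =>
    (curvePrimitive E).hasFDerivAt.comp q
      ((ContinuousMap.hasFDerivAt_comp_left (v i) (v' i) (hv i) q.2).comp q hasFDerivAt_snd)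
  have h2 : ∀ i, HasFDerivAt (fun q : (ι → ℝ) × C(I, E) => q.1 i)
      (ContinuousLinearMap.proj (R := ℝ) (φ := fun _ : ι => ℝ) i ∘L
        ContinuousLinearMap.fst ℝ (ι → ℝ) C(I, E)) q := fun i =>
    (ContinuousLinearMap.proj (R := ℝ) (φ := fun _ : ι => ℝ) i ∘L
        ContinuousLinearMap.fst ℝ (ι → ℝ) C(I, E)).hasFDerivAt
  have h3 := (hasFDerivAt_fst (𝕜 := ℝ) (p := q)).prodMk
    ((hasFDerivAt_snd (𝕜 := ℝ) (p := q)).sub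
      (HasFDerivAt.fun_sum (u := Finset.univ) fun i _ => (h2 i).smul (h1 i)))
  have h4 : HasFDerivAt (integralEquationMap v) _ q := h3
  rw [h4.fderiv]
  simp

/-- Joint time-one flow of commuting vector fields: a smooth map `Ψ(t, s)` with
`∂Ψ/∂tᵢ = vᵢ(Ψ)` and `Ψ(0, s) = s` to first order at `x₀`. -/
theorem exists_commuting_flow [DecidableEq ι] [CompleteSpace E] {v : ι → C(E, E)}
    (hv : ∀ i, ContDiff ℝ ∞ (v i)) {U : Set E} (hU : IsOpen U)
    (hcomm : ∀ x ∈ U, ∀ i j, fderiv ℝ (v i) x (v j x) = fderiv ℝ (v j) x (v i x))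
    {x₀ : E} (hx₀ : x₀ ∈ U) :
    ∃ (O : Set ((ι → ℝ) × E)) (Ψ : (ι → ℝ) × E → E), IsOpen O ∧ (0, x₀) ∈ O ∧
      ContDiffOn ℝ ∞ Ψ O ∧ (∀ p ∈ O, Ψ p ∈ U) ∧ Ψ (0, x₀) = x₀ ∧
      (∀ p ∈ O, ∀ i, fderiv ℝ Ψ p (Pi.single i 1, 0) = v i (Ψ p)) ∧
      ∀ b, fderiv ℝ Ψ (0, x₀) (0, b) = b := by
  have hn : (∞ : WithTop ℕ∞) ≠ 0 := by simp
  let v' : ι → C(E, E →L[ℝ] E) := fun i =>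
    ⟨fderiv ℝ (v i), ((hv i).continuous_fderiv hn)⟩
  have hv' : ∀ i x, HasFDerivAt (v i) (v' i x) x := fun i x =>
    ((hv i).differentiable hn x).hasFDerivAt
  let H := integralEquationMap v
  have hHs : ContDiff ℝ ∞ H := contDiff_integralEquationMap hv
  let c : E →L[ℝ] C(I, E) := ContinuousLinearMap.const ℝ I
  let q₀ : (ι → ℝ) × C(I, E) := (0, c x₀)
  let B : (ι → ℝ) →L[ℝ] C(I, E) := ∑ i, (ContinuousLinearMap.proj (R := ℝ)
    (φ := fun _ : ι => ℝ) i).smulRight (curvePrimitive E ((v i).comp (c x₀)))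
  let A : ((ι → ℝ) × C(I, E)) ≃L[ℝ] (ι → ℝ) × C(I, E) := ContinuousLinearEquiv.equivOfInverse
    ((ContinuousLinearMap.fst ℝ (ι → ℝ) C(I, E)).prod
      (ContinuousLinearMap.snd ℝ (ι → ℝ) C(I, E) - B ∘L ContinuousLinearMap.fst ℝ (ι → ℝ) C(I, E)))
    ((ContinuousLinearMap.fst ℝ (ι → ℝ) C(I, E)).prod
      (ContinuousLinearMap.snd ℝ (ι → ℝ) C(I, E) + B ∘L ContinuousLinearMap.fst ℝ (ι → ℝ) C(I, E)))
    (fun q => by simp) (fun q => by simp)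
  have hA : HasFDerivAt H (A : (ι → ℝ) × C(I, E) →L[ℝ] (ι → ℝ) × C(I, E)) q₀ := by
    have hAH : (A : (ι → ℝ) × C(I, E) →L[ℝ] (ι → ℝ) × C(I, E)) = fderiv ℝ H q₀ := by
      refine ContinuousLinearMap.ext fun ⟨a, w⟩ => ?_
      rw [fderiv_integralEquationMap hv']
      simp [A, B, q₀]
    rw [hAH]
    exact (hHs.differentiable hn q₀).hasFDerivAt
  let S : Set ((ι → ℝ) × C(I, E)) := {q | Set.MapsTo q.2 Set.univ U}
  have hS : IsOpen S :=
    (ContinuousMap.isOpen_setOfPred_mapsTo isCompact_univ hU).preimage continuous_snd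
  obtain ⟨e, heH, heq₀, heS, hesymm, hinv⟩ := exists_smooth_openPartialHomeomorph hS
    hHs.contDiffOn (x₀ := q₀) (fun _ _ => hx₀) A hA
  have hHq₀ : H q₀ = q₀ := by simp [H, q₀, integralEquationMap]
  let C : (ι → ℝ) × E →L[ℝ] (ι → ℝ) × C(I, E) :=
    (ContinuousLinearMap.id ℝ (ι → ℝ)).prodMap c
  let ev : (ι → ℝ) × C(I, E) →L[ℝ] E :=
    (ContinuousMap.evalCLM ℝ (1 : I)) ∘L ContinuousLinearMap.snd ℝ _ _
  have hO : IsOpen (C ⁻¹' e.target) := e.open_target.preimage C.continuous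
  have hΨ : ContDiffOn ℝ ∞ (fun p => ev (e.symm (C p))) (C ⁻¹' e.target) :=
    ev.contDiff.comp_contDiffOn (hesymm.comp C.contDiff.contDiffOn (Set.mapsTo_preimage _ _))
  have hCq₀ : C (0, x₀) = q₀ := rfl
  have heq₀' : e.symm q₀ = q₀ := by
    have := e.left_inv heq₀
    rwa [heH, hHq₀] at this
  have hfd : ∀ p ∈ C ⁻¹' e.target, ∀ a b, fderiv ℝ (fun p => ev (e.symm (C p))) p (a, b) =
      ev (fderiv ℝ e.symm (C p) (a, c b)) := by
    intro p hp a b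
    have h1 := ((hesymm.contDiffAt (e.open_target.mem_nhds hp)).differentiableAt hn).hasFDerivAt
    have h2 := ev.hasFDerivAt.comp p (h1.comp p C.hasFDerivAt)
    have h3 : HasFDerivAt (fun p => ev (e.symm (C p))) _ p := h2
    rw [h3.fderiv]
    rfl
  have h0 : ((0 : ι → ℝ), x₀) ∈ C ⁻¹' e.target := by
    have := e.map_source heq₀
    rwa [heH, hHq₀] at this
  refine ⟨C ⁻¹' e.target, fun p => ev (e.symm (C p)), hO, h0, hΨ, ?_, ?_, ?_, ?_⟩
  · intro p hp
    exact heS (e.map_target hp) (Set.mem_univ 1)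
  · simp only [hCq₀, heq₀']
    rfl
  · intro p hp i
    obtain ⟨t, s⟩ := p
    rw [hfd _ hp, map_zero]
    set q := e.symm (C (t, s)) with hq
    have hqs : q ∈ e.source := e.map_target hp
    have hHq : H q = C (t, s) := by rw [← heH]; exact e.right_inv hp
    obtain ⟨t', γ⟩ := q
    have ht : t' = t := congrArg Prod.fst hHq
    subst ht
    have hγ : γ = ContinuousMap.const I s + curvePrimitive E (∑ j, t' j • (v j).comp γ) := by
      have h2 : γ - ∑ j, t' j • curvePrimitive E ((v j).comp γ) = ContinuousMap.const I s :=
        congrArg Prod.snd hHq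
      rw [map_sum, ← h2]
      simp
    let w : C(I, E) := ⟨fun τ => (τ : ℝ) • v i (γ τ),
      continuous_subtype_val.smul ((v i).continuous.comp γ.continuous)⟩
    have hw : w = curvePrimitive E ((v i).comp γ +
        ∑ j, t' j • ContinuousMap.pointwiseApply I E E ((v' j).comp γ) w) := by
      refine smul_comp_eq_curvePrimitive hγ (g := v i) (g' := v' i) (hv' i) (fun _ => rfl) ?_
      intro τ
      have hU' : γ τ ∈ U := heS hqs (Set.mem_univ τ)
      simp only [ContinuousMap.add_apply, ContinuousMap.comp_apply, ContinuousMap.sum_apply,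
        ContinuousMap.smul_apply, ContinuousMap.pointwiseApply_apply, map_sum, map_smul,
        Finset.smul_sum]
      congr 1
      refine Finset.sum_congr rfl fun j _ => ?_
      have : v' i (γ τ) (v j (γ τ)) = v' j (γ τ) (v i (γ τ)) := hcomm _ hU' i j
      rw [this]
      change t' j • v' j (γ τ) ((τ : ℝ) • v i (γ τ)) = _
      rw [map_smul, smul_comm]
    have hDH : fderiv ℝ H (t', γ) (Pi.single i 1, w) = (Pi.single i 1, 0) := by
      rw [fderiv_integralEquationMap hv']
      refine Prod.ext rfl ?_
      simp only [Finset.sum_add_distrib, Pi.single_apply, ite_smul, one_smul, zero_smul,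
        Finset.sum_ite_eq', Finset.mem_univ, if_true]
      nth_rewrite 1 [hw]
      rw [map_add, map_sum]
      simp only [map_smul]
      abel
    have h3 := hinv _ hqs (Pi.single i 1, w)
    have h4 : H (t', γ) = C (t', s) := hHq
    rw [hDH] at h3
    rw [← h4, h3]
    have h5 : e.symm (C (t', s)) = (t', γ) := hq.symm
    simp only [h5]
    change ((1 : I) : ℝ) • v i (γ 1) = v i (γ 1)
    simp
  · intro b
    rw [hfd _ h0, hCq₀]
    have hDH : fderiv ℝ H q₀ (0, c b) = (0, c b) := by
      rw [fderiv_integralEquationMap hv']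
      simp [q₀]
    have h3 := hinv _ heq₀ (0, c b)
    rw [hDH, hHq₀] at h3
    rw [h3]
    rfl

end Flow

section Straightening

universe u

variable {ι : Type*} [Fintype ι] {E : Type u} [NormedAddCommGroup E] [NormedSpace ℝ E]
  [FiniteDimensional ℝ E]

/-- A smooth map on an open set agrees near any given point with a globally smooth map. -/
theorem exists_contDiff_eqOn_ball {F : Type*} [NormedAddCommGroup F] [NormedSpace ℝ F] {U : Set E}
    (hU : IsOpen U) {x₀ : E} (hx₀ : x₀ ∈ U) :
    ∃ δ > 0, Metric.ball x₀ δ ⊆ U ∧ ∀ f : E → F, ContDiffOn ℝ ∞ f U →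
      ∃ g : E → F, ContDiff ℝ ∞ g ∧ Set.EqOn g f (Metric.ball x₀ δ) := by
  obtain ⟨R, hR, hRU⟩ := Metric.nhds_basis_closedBall.mem_iff.1 (hU.mem_nhds hx₀)
  let χ : ContDiffBump x₀ := ⟨R / 2, R, half_pos hR, half_lt_self hR⟩
  refine ⟨R / 2, half_pos hR, fun x hx => hRU (Metric.ball_subset_closedBall
    (Metric.ball_subset_ball (half_le_self hR.le) hx)), fun f hf => ⟨fun x => χ x • f x, ?_, ?_⟩⟩
  · rw [contDiff_iff_contDiffAt]
    intro x
    by_cases hx : x ∈ U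
    · exact χ.contDiffAt.smul (hf.contDiffAt (hU.mem_nhds hx))
    · have hx' : x ∉ tsupport χ := by
        rw [χ.tsupport_eq]
        exact fun h => hx (hRU h)
      have h0 : (fun x => χ x • f x) =ᶠ[nhds x] fun _ => 0 := by
        filter_upwards [(isClosed_tsupport χ).isOpen_compl.mem_nhds hx'] with y hy
        rw [image_eq_zero_of_notMem_tsupport hy, zero_smul]
      exact contDiffAt_const.congr_of_eventuallyEq h0
  · intro x hx
    have : χ x = 1 := χ.one_of_mem_closedBall (Metric.ball_subset_closedBall hx)
    simp [this]

/-- Linearly independent vectors extend to a linear system of coordinates. -/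
theorem exists_continuousLinearEquiv_extending {b : ι → E} (hb : LinearIndependent ℝ b) {k : ℕ}
    (hk : k + Fintype.card ι = Module.finrank ℝ E) :
    ∃ (L : (Fin k → ℝ) →L[ℝ] E) (M : ((ι → ℝ) × (Fin k → ℝ)) ≃L[ℝ] E),
      ∀ a c, M (a, c) = ∑ i, a i • b i + L c := by
  classical
  obtain ⟨W, hW⟩ := Submodule.exists_isCompl (Submodule.span ℝ (Set.range b))
  have h1 := Submodule.finrank_add_eq_of_isCompl hW
  rw [finrank_span_eq_card hb] at h1
  have h2 : Module.finrank ℝ (Fin k → ℝ) = Module.finrank ℝ W := by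
    rw [Module.finrank_fin_fun]; omega
  let l : (Fin k → ℝ) ≃ₗ[ℝ] W := LinearEquiv.ofFinrankEq _ _ h2
  let L : (Fin k → ℝ) →ₗ[ℝ] E := W.subtype ∘ₗ l.toLinearMap
  let T : (ι → ℝ) →ₗ[ℝ] E := Fintype.linearCombination ℝ b
  have hinj : Function.Injective (T.coprod L) := by
    rw [← LinearMap.ker_eq_bot, LinearMap.ker_eq_bot']
    rintro ⟨a, c⟩ h
    rw [LinearMap.coprod_apply] at h
    have hTa : T a ∈ Submodule.span ℝ (Set.range b) := by
      rw [Fintype.linearCombination_apply]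
      exact Submodule.sum_mem _ fun i _ =>
        Submodule.smul_mem _ _ (Submodule.subset_span ⟨i, rfl⟩)
    have hTa' : T a ∈ W := by
      rw [eq_neg_of_add_eq_zero_left h]
      exact W.neg_mem (l c).2
    have hT0 : T a = 0 := Submodule.disjoint_def.1 hW.disjoint _ hTa hTa'
    have ha : a = 0 := by
      rw [Fintype.linearCombination_apply] at hT0
      exact funext (Fintype.linearIndependent_iff.1 hb a hT0)
    rw [hT0, zero_add] at h
    have hc : c = 0 := l.map_eq_zero_iff.1 (Subtype.ext h)
    rw [ha, hc]; rfl
  have hfr : Module.finrank ℝ ((ι → ℝ) × (Fin k → ℝ)) = Module.finrank ℝ E := by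
    rw [Module.finrank_prod, Module.finrank_fin_fun, Module.finrank_fintype_fun_eq_card]; omega
  refine ⟨LinearMap.toContinuousLinearMap L,
    ((T.coprod L).linearEquivOfInjective hinj hfr).toContinuousLinearEquiv, fun a c => ?_⟩
  simp [T, Fintype.linearCombination_apply]

/-- Simultaneous straightening of commuting, linearly independent vector fields. -/
theorem exists_straightening [DecidableEq ι] {v : ι → E → E} {U : Set E} (hU : IsOpen U)
    (hv : ∀ i, ContDiffOn ℝ ∞ (v i) U)
    (hcomm : ∀ x ∈ U, ∀ i j, fderiv ℝ (v i) x (v j x) = fderiv ℝ (v j) x (v i x))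
    {x₀ : E} (hx₀ : x₀ ∈ U) (hli : LinearIndependent ℝ fun i => v i x₀) {k : ℕ}
    (hk : k + Fintype.card ι = Module.finrank ℝ E) :
    ∃ V : Set E, IsOpen V ∧ x₀ ∈ V ∧ V ⊆ U ∧ ∃ (Y : E → ι → ℝ) (Z : E → Fin k → ℝ),
      ContDiffOn ℝ ∞ Y V ∧ ContDiffOn ℝ ∞ Z V ∧ Y x₀ = 0 ∧ Z x₀ = 0 ∧
      (∀ x ∈ V, ∀ i, fderiv ℝ Y x (v i x) = Pi.single i 1) ∧
      (∀ x ∈ V, ∀ i, fderiv ℝ Z x (v i x) = 0) ∧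
      ∀ w, fderiv ℝ Y x₀ w = 0 → fderiv ℝ Z x₀ w = 0 → w = 0 := by
  have hn : (∞ : WithTop ℕ∞) ≠ 0 := by simp
  have : CompleteSpace E := FiniteDimensional.complete ℝ E
  obtain ⟨δ, hδ, hδU, hext⟩ := exists_contDiff_eqOn_ball (F := E) hU hx₀
  choose g hg hgv using fun i => hext (v i) (hv i)
  have hfd : ∀ x ∈ Metric.ball x₀ δ, ∀ i, fderiv ℝ (g i) x = fderiv ℝ (v i) x := fun x hx i =>
    ((hgv i).eventuallyEq_of_mem (Metric.isOpen_ball.mem_nhds hx)).fderiv_eq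
  have hgcomm : ∀ x ∈ Metric.ball x₀ δ, ∀ i j,
      fderiv ℝ (g i) x (g j x) = fderiv ℝ (g j) x (g i x) := by
    intro x hx i j
    rw [hfd x hx, hfd x hx, hgv i hx, hgv j hx]
    exact hcomm x (hδU hx) i j
  obtain ⟨O, Ψ, hO, h0O, hΨ, hΨU, hΨ0, hΨv, hΨb⟩ := exists_commuting_flow
    (v := fun i => (⟨g i, (hg i).continuous⟩ : C(E, E))) hg Metric.isOpen_ball hgcomm
    (Metric.mem_ball_self hδ)
  obtain ⟨L, M, hM⟩ := exists_continuousLinearEquiv_extending hli hk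
  let A : (ι → ℝ) × (Fin k → ℝ) → (ι → ℝ) × E := fun p => (p.1, x₀ + L p.2)
  let A' : (ι → ℝ) × (Fin k → ℝ) →L[ℝ] (ι → ℝ) × E := (ContinuousLinearMap.id ℝ (ι → ℝ)).prodMap L
  have hAd : ∀ p, HasFDerivAt A A' p := fun p =>
    hasFDerivAt_fst.prodMk ((L.hasFDerivAt.comp p hasFDerivAt_snd).const_add x₀)
  have hAs : ContDiff ℝ ∞ A :=
    contDiff_fst.prodMk (contDiff_const.add (L.contDiff.comp contDiff_snd))
  have hA0 : A 0 = (0, x₀) := by simp [A]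
  have hΨd : ∀ p ∈ A ⁻¹' O, HasFDerivAt (Ψ ∘ A) (fderiv ℝ Ψ (A p) ∘L A') p := fun p hp =>
    ((hΨ.contDiffAt (hO.mem_nhds hp)).differentiableAt hn).hasFDerivAt.comp p (hAd p)
  have h0 : (0 : (ι → ℝ) × (Fin k → ℝ)) ∈ A ⁻¹' O := by
    rw [Set.mem_preimage, hA0]; exact h0O
  have hΨv' : ∀ p ∈ A ⁻¹' O, ∀ i, fderiv ℝ (Ψ ∘ A) p (Pi.single i 1, 0) = v i (Ψ (A p)) := by
    intro p hp i
    rw [(hΨd p hp).fderiv, ← hgv i (hΨU _ hp)]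
    have := hΨv _ hp i
    simpa [A'] using this
  have hM0 : HasFDerivAt (Ψ ∘ A) (M : (ι → ℝ) × (Fin k → ℝ) →L[ℝ] E) 0 := by
    have hMΨ : (M : (ι → ℝ) × (Fin k → ℝ) →L[ℝ] E) = fderiv ℝ (Ψ ∘ A) 0 := by
      refine ContinuousLinearMap.ext fun ⟨a, c⟩ => ?_
      have hac : (a, c) = ∑ i, a i • ((Pi.single i 1, 0) : (ι → ℝ) × (Fin k → ℝ)) + (0, c) := by
        refine Prod.ext ?_ ?_
        · simp [Prod.fst_sum, ← pi_eq_sum_univ']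
        · simp [Prod.snd_sum]
      have h1 : fderiv ℝ (Ψ ∘ A) 0 (0, c) = L c := by
        rw [(hΨd 0 h0).fderiv, hA0]
        exact hΨb (L c)
      rw [ContinuousLinearEquiv.coe_coe, hM]
      conv_rhs => rw [hac, map_add, map_sum, h1]
      simp only [map_smul, hΨv' 0 h0, hA0, hΨ0]
    rw [hMΨ]
    exact (hΨd 0 h0).differentiableAt.hasFDerivAt
  obtain ⟨e, heΨ, h0e, heO, hes, hinv⟩ := exists_smooth_openPartialHomeomorph
    (hO.preimage hAs.continuous) (hΨ.comp hAs.contDiffOn (Set.mapsTo_preimage _ _)) h0 M hM0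
  have he0 : e 0 = x₀ := by rw [heΨ, Function.comp_apply, hA0, hΨ0]
  have hx₀e : x₀ ∈ e.target := he0 ▸ e.map_source h0e
  have hes0 : e.symm x₀ = 0 := by rw [← he0]; exact e.left_inv h0e
  have hed : ∀ x ∈ e.target, HasFDerivAt e.symm (fderiv ℝ e.symm x) x := fun x hx =>
    ((hes.contDiffAt (e.open_target.mem_nhds hx)).differentiableAt hn).hasFDerivAt
  have hY : ∀ x ∈ e.target, fderiv ℝ (fun x => (e.symm x).1) x =
      ContinuousLinearMap.fst ℝ _ _ ∘L fderiv ℝ e.symm x := fun x hx => (hed x hx).fst.fderiv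
  have hZ : ∀ x ∈ e.target, fderiv ℝ (fun x => (e.symm x).2) x =
      ContinuousLinearMap.snd ℝ _ _ ∘L fderiv ℝ e.symm x := fun x hx => (hed x hx).snd.fderiv
  have hev : ∀ x ∈ e.target, ∀ i, fderiv ℝ e.symm x (v i x) = (Pi.single i 1, 0) := by
    intro x hx i
    have hs := e.map_target hx
    have h1 := hinv _ hs (Pi.single i 1, 0)
    rw [hΨv' _ (heO hs)] at h1
    have h2 : Ψ (A (e.symm x)) = x := by
      have := e.right_inv hx
      rwa [heΨ] at this
    rwa [Function.comp_apply, h2] at h1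
  refine ⟨e.target, e.open_target, hx₀e, ?_, fun x => (e.symm x).1, fun x => (e.symm x).2,
    hes.fst, hes.snd, by simp [hes0], by simp [hes0], ?_, ?_, ?_⟩
  · intro x hx
    have := e.right_inv hx
    rw [heΨ] at this
    rw [← this]
    exact hδU (hΨU _ (heO (e.map_target hx)))
  · intro x hx i
    rw [hY x hx, ContinuousLinearMap.comp_apply, hev x hx]; rfl
  · intro x hx i
    rw [hZ x hx, ContinuousLinearMap.comp_apply, hev x hx]; rfl
  · intro w h1 h2
    rw [hY x₀ hx₀e] at h1
    rw [hZ x₀ hx₀e] at h2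
    have h3 : fderiv ℝ e.symm x₀ w = 0 := Prod.ext h1 h2
    have h4 := hinv 0 h0e (M.symm w)
    rw [hM0.fderiv, Function.comp_apply, hA0, hΨ0, ContinuousLinearEquiv.coe_coe,
      M.apply_symm_apply, h3] at h4
    rw [← M.apply_symm_apply w, ← h4, map_zero]

end Straightening

section Poisson

variable {n : ℕ}

theorem fderiv_apply_eq_sum_pd (f : (Fin n → ℝ) → ℝ) (x w : Fin n → ℝ) :
    fderiv ℝ f x w = ∑ i, w i * pd i f x := by
  conv_lhs => rw [pi_eq_sum_univ' w]
  simp [pd]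

theorem pbrak_eq_fderiv_ham (P : (Fin n → ℝ) → Matrix (Fin n) (Fin n) ℝ)
    (f g : (Fin n → ℝ) → ℝ) (x : Fin n → ℝ) :
    pbrak P f g x = fderiv ℝ f x (ham P g x) := by
  rw [fderiv_apply_eq_sum_pd]
  refine Finset.sum_congr rfl fun i _ => ?_
  rw [ham, Finset.sum_mul]
  exact Finset.sum_congr rfl fun j _ => by ring

theorem IsPoissonMatrix.pbrak_swap {P : (Fin n → ℝ) → Matrix (Fin n) (Fin n) ℝ}
    {U : Set (Fin n → ℝ)} (hP : IsPoissonMatrix P U) {x : Fin n → ℝ} (hx : x ∈ U)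
    (f g : (Fin n → ℝ) → ℝ) : pbrak P f g x = -pbrak P g f x := by
  unfold pbrak
  rw [Finset.sum_comm, ← Finset.sum_neg_distrib]
  refine Finset.sum_congr rfl fun i _ => ?_
  rw [← Finset.sum_neg_distrib]
  refine Finset.sum_congr rfl fun j _ => ?_
  rw [hP.2.1 x hx j i]
  ring

theorem ContDiffOn.pd {f : (Fin n → ℝ) → ℝ} {V : Set (Fin n → ℝ)} (hV : IsOpen V)
    (hf : ContDiffOn ℝ ∞ f V) (i : Fin n) : ContDiffOn ℝ ∞ (pd i f) V :=
  (hf.fderiv_of_isOpen hV (by simp)).clm_apply contDiffOn_const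

theorem IsPoissonMatrix.contDiffOn_pbrak {P : (Fin n → ℝ) → Matrix (Fin n) (Fin n) ℝ}
    {U V : Set (Fin n → ℝ)} (hP : IsPoissonMatrix P U) (hV : IsOpen V) (hVU : V ⊆ U)
    {f g : (Fin n → ℝ) → ℝ} (hf : ContDiffOn ℝ ∞ f V) (hg : ContDiffOn ℝ ∞ g V) :
    ContDiffOn ℝ ∞ (pbrak P f g) V :=
  ContDiffOn.sum fun i _ => ContDiffOn.sum fun j _ =>
    (((hP.1 i j).mono hVU).mul (hf.pd hV i)).mul (hg.pd hV j)

theorem IsPoissonMatrix.contDiffOn_ham {P : (Fin n → ℝ) → Matrix (Fin n) (Fin n) ℝ}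
    {U V : Set (Fin n → ℝ)} (hP : IsPoissonMatrix P U) (hV : IsOpen V) (hVU : V ⊆ U)
    {f : (Fin n → ℝ) → ℝ} (hf : ContDiffOn ℝ ∞ f V) : ContDiffOn ℝ ∞ (ham P f) V :=
  contDiffOn_pi.2 fun i => ContDiffOn.sum fun j _ => ((hP.1 i j).mono hVU).mul (hf.pd hV j)

theorem IsPoissonMatrix.fderiv_pbrak {P : (Fin n → ℝ) → Matrix (Fin n) (Fin n) ℝ}
    {U V : Set (Fin n → ℝ)} (hP : IsPoissonMatrix P U) (hV : IsOpen V) (hVU : V ⊆ U)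
    {f g : (Fin n → ℝ) → ℝ} (hf : ContDiffOn ℝ ∞ f V) (hg : ContDiffOn ℝ ∞ g V)
    {x : Fin n → ℝ} (hx : x ∈ V) (u : Fin n → ℝ) :
    fderiv ℝ (pbrak P f g) x u =
      ∑ i, ∑ j, fderiv ℝ (fun y => P y i j) x u * pd i f x * pd j g x
      + fderiv ℝ (fderiv ℝ f) x u (ham P g x) - fderiv ℝ (fderiv ℝ g) x u (ham P f x) := by
  have hn : (∞ : WithTop ℕ∞) ≠ 0 := by simp
  have hPd : ∀ i j, HasFDerivAt (fun y => P y i j) (fderiv ℝ (fun y => P y i j) x) x := fun i j =>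
    (((hP.1 i j).mono hVU).contDiffAt (hV.mem_nhds hx)).differentiableAt hn |>.hasFDerivAt
  have hpd : ∀ {f : (Fin n → ℝ) → ℝ}, ContDiffOn ℝ ∞ f V → ∀ i,
      HasFDerivAt (pd i f) ((fderiv ℝ (fderiv ℝ f) x).flip (Pi.single i 1)) x := by
    intro f hf i
    have h1 : HasFDerivAt (fderiv ℝ f) (fderiv ℝ (fderiv ℝ f) x) x :=
      (((hf.fderiv_of_isOpen (m := ∞) hV (by simp)).contDiffAt
        (hV.mem_nhds hx)).differentiableAt hn).hasFDerivAt
    have h2 := h1.clm_apply (hasFDerivAt_const (Pi.single i (1 : ℝ)) x)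
    have h3 : HasFDerivAt (pd i f) _ x := h2
    refine h3.congr_fderiv ?_
    ext; simp
  have h := HasFDerivAt.fun_sum (u := Finset.univ) fun i _ => HasFDerivAt.fun_sum
    (u := Finset.univ) fun j _ => ((hPd i j).mul (hpd hf i)).mul (hpd hg j)
  have h' : HasFDerivAt (pbrak P f g) _ x := h
  have hswap : ∀ (l : (Fin n → ℝ) →L[ℝ] ℝ) (h : (Fin n → ℝ) → ℝ),
      l (ham P h x) = ∑ i, ∑ j, P x i j * l (Pi.single i 1) * pd j h x := by
    intro l h
    conv_lhs => rw [pi_eq_sum_univ' (ham P h x)]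
    simp only [map_sum, map_smul, smul_eq_mul, ham, Finset.sum_mul]
    exact Finset.sum_congr rfl fun i _ => Finset.sum_congr rfl fun j _ => by ring
  have hswap' : fderiv ℝ (fderiv ℝ g) x u (ham P f x) =
      -∑ i, ∑ j, P x i j * pd i f x * fderiv ℝ (fderiv ℝ g) x u (Pi.single j 1) := by
    rw [hswap, Finset.sum_comm, ← Finset.sum_neg_distrib]
    refine Finset.sum_congr rfl fun i _ => ?_
    rw [← Finset.sum_neg_distrib]
    refine Finset.sum_congr rfl fun j _ => ?_
    rw [hP.2.1 x (hVU hx) j i]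
    ring
  rw [h'.fderiv, hswap', hswap, sub_neg_eq_add, ← Finset.sum_add_distrib,
    ← Finset.sum_add_distrib]
  simp only [sum_apply]
  refine Finset.sum_congr rfl fun i _ => ?_
  rw [← Finset.sum_add_distrib, ← Finset.sum_add_distrib]
  refine Finset.sum_congr rfl fun j _ => ?_
  simp
  ring

/-- The Jacobi identity for the Poisson bracket of smooth functions. -/
theorem IsPoissonMatrix.jacobi {P : (Fin n → ℝ) → Matrix (Fin n) (Fin n) ℝ}
    {U V : Set (Fin n → ℝ)} (hP : IsPoissonMatrix P U) (hV : IsOpen V) (hVU : V ⊆ U)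
    {f g h : (Fin n → ℝ) → ℝ} (hf : ContDiffOn ℝ ∞ f V) (hg : ContDiffOn ℝ ∞ g V)
    (hh : ContDiffOn ℝ ∞ h V) {x : Fin n → ℝ} (hx : x ∈ V) :
    pbrak P (pbrak P f g) h x + pbrak P (pbrak P g h) f x + pbrak P (pbrak P h f) g x = 0 := by
  have hsymm : ∀ {f : (Fin n → ℝ) → ℝ}, ContDiffOn ℝ ∞ f V → ∀ u w,
      fderiv ℝ (fderiv ℝ f) x u w = fderiv ℝ (fderiv ℝ f) x w u := by
    intro f hf u w
    exact (hf.contDiffAt (hV.mem_nhds hx)).isSymmSndFDerivAt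
      (by rw [minSmoothness_of_isRCLikeNormedField]; exact WithTop.coe_le_coe.2 le_top) u w
  let Q : Fin n → Fin n → Fin n → ℝ := fun i j k => ∑ l, P x l k * pd l (fun y => P y i j) x
  have hT : ∀ f g h : (Fin n → ℝ) → ℝ,
      ∑ i, ∑ j, fderiv ℝ (fun y => P y i j) x (ham P h x) * pd i f x * pd j g x =
        ∑ i, ∑ j, ∑ k, Q i j k * (pd i f x * pd j g x * pd k h x) := by
    intro f g h
    refine Finset.sum_congr rfl fun i _ => Finset.sum_congr rfl fun j _ => ?_
    rw [fderiv_apply_eq_sum_pd]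
    simp only [ham, Q, Finset.sum_mul]
    rw [Finset.sum_comm]
    exact Finset.sum_congr rfl fun k _ => Finset.sum_congr rfl fun l _ => by ring
  have hsum : ∑ i, ∑ j, ∑ k, Q i j k * (pd i f x * pd j g x * pd k h x)
      + ∑ j, ∑ k, ∑ i, Q j k i * (pd j g x * pd k h x * pd i f x)
      + ∑ k, ∑ i, ∑ j, Q k i j * (pd k h x * pd i f x * pd j g x) = 0 := by
    have h1 : ∑ j, ∑ k, ∑ i, Q j k i * (pd j g x * pd k h x * pd i f x) =
        ∑ i, ∑ j, ∑ k, Q j k i * (pd j g x * pd k h x * pd i f x) := by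
      exact (Finset.sum_congr rfl fun j _ => Finset.sum_comm).trans Finset.sum_comm
    have h2 : ∑ k, ∑ i, ∑ j, Q k i j * (pd k h x * pd i f x * pd j g x) =
        ∑ i, ∑ j, ∑ k, Q k i j * (pd k h x * pd i f x * pd j g x) := by
      rw [Finset.sum_comm]
      exact Finset.sum_congr rfl fun i _ => Finset.sum_comm
    rw [h1, h2, ← Finset.sum_add_distrib, ← Finset.sum_add_distrib]
    refine Finset.sum_eq_zero fun i _ => ?_
    rw [← Finset.sum_add_distrib, ← Finset.sum_add_distrib]
    refine Finset.sum_eq_zero fun j _ => ?_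
    rw [← Finset.sum_add_distrib, ← Finset.sum_add_distrib]
    refine Finset.sum_eq_zero fun k _ => ?_
    have hJ := hP.2.2 x (hVU hx) i j k
    rw [Finset.sum_add_distrib, Finset.sum_add_distrib] at hJ
    have hJ' : Q i j k + Q j k i + Q k i j = 0 := hJ
    linear_combination (pd i f x * pd j g x * pd k h x) * hJ'
  rw [pbrak_eq_fderiv_ham, pbrak_eq_fderiv_ham P (pbrak P g h), pbrak_eq_fderiv_ham P (pbrak P h f),
    hP.fderiv_pbrak hV hVU hf hg hx, hP.fderiv_pbrak hV hVU hg hh hx,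
    hP.fderiv_pbrak hV hVU hh hf hx, hT, hT, hT,
    hsymm hf (ham P g x), hsymm hg (ham P h x), hsymm hh (ham P f x)]
  linear_combination hsum

end Poisson

section CanonicalFunctions

variable {n : ℕ} {P : (Fin n → ℝ) → Matrix (Fin n) (Fin n) ℝ} {U V : Set (Fin n → ℝ)}

theorem pbrak_eq_zero_of_eqOn_const (hV : IsOpen V) {x : Fin n → ℝ} (hx : x ∈ V)
    {f : (Fin n → ℝ) → ℝ} {c : ℝ} (hf : ∀ y ∈ V, f y = c) (g : (Fin n → ℝ) → ℝ) :
    pbrak P f g x = 0 := by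
  have h : f =ᶠ[nhds x] fun _ => c := by
    filter_upwards [hV.mem_nhds hx] with y hy using hf y hy
  rw [pbrak_eq_fderiv_ham, h.fderiv_eq]
  simp

/-- Hamiltonian vector fields of functions with constant bracket commute. -/
theorem IsPoissonMatrix.ham_commute (hP : IsPoissonMatrix P U) (hV : IsOpen V) (hVU : V ⊆ U)
    {f g : (Fin n → ℝ) → ℝ} (hf : ContDiffOn ℝ ∞ f V) (hg : ContDiffOn ℝ ∞ g V) {c : ℝ}
    (hfg : ∀ x ∈ V, pbrak P f g x = c) {x : Fin n → ℝ} (hx : x ∈ V) :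
    fderiv ℝ (ham P f) x (ham P g x) = fderiv ℝ (ham P g) x (ham P f x) := by
  have hn : (∞ : WithTop ℕ∞) ≠ 0 := by simp
  ext k
  let e : (Fin n → ℝ) → ℝ := fun y => y k
  have he : ContDiffOn ℝ ∞ e V := (contDiff_apply ℝ ℝ k).contDiffOn
  have hcoord : ∀ h : (Fin n → ℝ) → ℝ, pbrak P e h = fun y => ham P h y k := by
    intro h
    funext y
    rw [pbrak_eq_fderiv_ham]
    exact congrArg (fun L : (Fin n → ℝ) →L[ℝ] ℝ => L (ham P h y))
      (ContinuousLinearMap.proj (R := ℝ) (φ := fun _ : Fin n => ℝ) k).fderiv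
  have hcomp : ∀ {h : (Fin n → ℝ) → ℝ}, ContDiffOn ℝ ∞ h V → ∀ u,
      fderiv ℝ (ham P h) x u k = fderiv ℝ (pbrak P e h) x u := by
    intro h hh u
    have hd : HasFDerivAt (ham P h) (fderiv ℝ (ham P h) x) x :=
      (((hP.contDiffOn_ham hV hVU hh).contDiffAt (hV.mem_nhds hx)).differentiableAt hn).hasFDerivAt
    rw [hcoord, ((hasFDerivAt_pi'.1 hd) k).fderiv]
    rfl
  rw [hcomp hf, hcomp hg, ← pbrak_eq_fderiv_ham, ← pbrak_eq_fderiv_ham]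
  have hJ := hP.jacobi hV hVU he hf hg hx
  have hge : pbrak P (pbrak P g e) f x = -pbrak P (pbrak P e g) f x := by
    have h1 : pbrak P g e =ᶠ[nhds x] fun y => -pbrak P e g y := by
      filter_upwards [hV.mem_nhds hx] with y hy using hP.pbrak_swap (hVU hy) g e
    rw [pbrak_eq_fderiv_ham, h1.fderiv_eq, fderiv_fun_neg, pbrak_eq_fderiv_ham]
    rfl
  rw [pbrak_eq_zero_of_eqOn_const hV hx hfg, hge] at hJ
  linarith

/-- Functions with constant mutual brackets and independent Hamiltonian vector fields admit a dual
system of functions, completed by common Casimir-type functions to local coordinates. -/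
theorem IsPoissonMatrix.exists_dual_functions (hP : IsPoissonMatrix P U) (hV : IsOpen V)
    (hVU : V ⊆ U) {ι : Type*} [Fintype ι] [DecidableEq ι] {f : ι → (Fin n → ℝ) → ℝ}
    (hf : ∀ a, ContDiffOn ℝ ∞ (f a) V) (hff : ∀ a b, ∃ c, ∀ x ∈ V, pbrak P (f a) (f b) x = c)
    {x₀ : Fin n → ℝ} (hx₀ : x₀ ∈ V) (hli : LinearIndependent ℝ fun a => ham P (f a) x₀) {k : ℕ}
    (hk : k + Fintype.card ι = n) :
    ∃ V' : Set (Fin n → ℝ), IsOpen V' ∧ x₀ ∈ V' ∧ V' ⊆ V ∧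
      ∃ (Y : ι → (Fin n → ℝ) → ℝ) (Z : Fin k → (Fin n → ℝ) → ℝ),
      (∀ a, ContDiffOn ℝ ∞ (Y a) V') ∧ (∀ l, ContDiffOn ℝ ∞ (Z l) V') ∧
      (∀ a, Y a x₀ = 0) ∧ (∀ l, Z l x₀ = 0) ∧
      (∀ x ∈ V', ∀ a b, pbrak P (Y a) (f b) x = if a = b then 1 else 0) ∧
      (∀ x ∈ V', ∀ l b, pbrak P (Z l) (f b) x = 0) ∧
      ∀ w, (∀ a, fderiv ℝ (Y a) x₀ w = 0) → (∀ l, fderiv ℝ (Z l) x₀ w = 0) → w = 0 := by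
  have hn : (∞ : WithTop ℕ∞) ≠ 0 := by simp
  obtain ⟨V', hV', hx₀', hV'V, Y, Z, hY, hZ, hY0, hZ0, hYv, hZv, hinj⟩ :=
    exists_straightening (v := fun a => ham P (f a)) hV
      (fun a => hP.contDiffOn_ham hV hVU (hf a))
      (fun x hx a b => by
        obtain ⟨c, hc⟩ := hff a b
        exact hP.ham_commute hV hVU (hf a) (hf b) hc hx) hx₀ hli (k := k) (by simpa using hk)
  have hYd : ∀ x ∈ V', ∀ a w, fderiv ℝ (fun y => Y y a) x w = fderiv ℝ Y x w a := by
    intro x hx a w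
    rw [((hasFDerivAt_pi'.1
      ((hY.contDiffAt (hV'.mem_nhds hx)).differentiableAt hn).hasFDerivAt) a).fderiv]
    rfl
  have hZd : ∀ x ∈ V', ∀ l w, fderiv ℝ (fun y => Z y l) x w = fderiv ℝ Z x w l := by
    intro x hx l w
    rw [((hasFDerivAt_pi'.1
      ((hZ.contDiffAt (hV'.mem_nhds hx)).differentiableAt hn).hasFDerivAt) l).fderiv]
    rfl
  refine ⟨V', hV', hx₀', hV'V, fun a x => Y x a, fun l x => Z x l, contDiffOn_pi.1 hY,
    contDiffOn_pi.1 hZ, fun a => congrFun hY0 a, fun l => congrFun hZ0 l, ?_, ?_, ?_⟩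
  · intro x hx a b
    rw [pbrak_eq_fderiv_ham, hYd x hx, hYv x hx, Pi.single_apply]
  · intro x hx l b
    rw [pbrak_eq_fderiv_ham, hZd x hx, hZv x hx]; rfl
  · intro w h1 h2
    exact hinj w (funext fun a => (hYd x₀ hx₀' a w).symm.trans (h1 a))
      (funext fun l => (hZd x₀ hx₀' l w).symm.trans (h2 l))

/-- Adjoining conjugate functions keeps the Hamiltonian vectors independent. -/
theorem IsPoissonMatrix.linearIndependent_ham_sumElim (hP : IsPoissonMatrix P U)
    {x₀ : Fin n → ℝ} (hx₀ : x₀ ∈ U) {r : ℕ} {p : Fin r → (Fin n → ℝ) → ℝ}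
    (hpp : ∀ i j, pbrak P (p i) (p j) x₀ = 0) (hli : LinearIndependent ℝ fun i => ham P (p i) x₀)
    {κ : Type*} [Fintype κ] {c : κ → Fin r} (hc : Function.Injective c)
    {q : κ → (Fin n → ℝ) → ℝ} (hqp : ∀ i j, pbrak P (q i) (p j) x₀ = if c i = j then 1 else 0) :
    LinearIndependent ℝ fun a => ham P (Sum.elim p q a) x₀ := by
  classical
  rw [Fintype.linearIndependent_iff] at hli ⊢
  intro g hg
  rw [Fintype.sum_sum_type] at hg
  simp only [Sum.elim_inl, Sum.elim_inr] at hg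
  have hinr : ∀ j, g (Sum.inr j) = 0 := by
    intro j
    have h := congrArg (fderiv ℝ (p (c j)) x₀) hg
    simp only [map_add, map_sum, map_smul, map_zero, ← pbrak_eq_fderiv_ham, hpp, smul_zero,
      Finset.sum_const_zero, zero_add] at h
    simp only [hP.pbrak_swap hx₀ (p (c j)), hqp, hc.eq_iff] at h
    simpa using h
  simp only [hinr, zero_smul, Finset.sum_const_zero, add_zero] at hg
  rintro (i | j)
  · exact hli _ hg i
  · exact hinr j

/-- Commuting functions with independent Hamiltonian vector fields admit commuting conjugate
functions. -/
theorem IsPoissonMatrix.exists_conjugate_functions (hP : IsPoissonMatrix P U) (hU : IsOpen U)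
    {x₀ : Fin n → ℝ} (hx₀ : x₀ ∈ U) {r : ℕ} {p : Fin r → (Fin n → ℝ) → ℝ}
    (hp : ∀ i, ContDiffOn ℝ ∞ (p i) U) (hpp : ∀ i j, ∀ x ∈ U, pbrak P (p i) (p j) x = 0)
    (hli : LinearIndependent ℝ fun i => ham P (p i) x₀) (s : Finset (Fin r)) :
    ∃ V : Set (Fin n → ℝ), IsOpen V ∧ x₀ ∈ V ∧ V ⊆ U ∧ ∃ q : Fin r → (Fin n → ℝ) → ℝ,
      (∀ i ∈ s, ContDiffOn ℝ ∞ (q i) V) ∧ (∀ i ∈ s, q i x₀ = 0) ∧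
      (∀ x ∈ V, ∀ i ∈ s, ∀ j, pbrak P (q i) (p j) x = if i = j then 1 else 0) ∧
      ∀ x ∈ V, ∀ i ∈ s, ∀ j ∈ s, pbrak P (q i) (q j) x = 0 := by
  induction s using Finset.induction_on with
  | empty => exact ⟨U, hU, hx₀, subset_rfl, fun _ _ => 0, by simp⟩
  | insert a s ha ih =>
    obtain ⟨V, hV, hxV, hVU, q, hq, hq0, hqp, hqq⟩ := ih
    have hli' := hP.linearIndependent_ham_sumElim hx₀ (fun i j => hpp i j x₀ hx₀) hli
      (c := fun i : s => (i : Fin r)) Subtype.val_injective (q := fun i : s => q i)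
      (fun i j => hqp x₀ hxV i i.2 j)
    have hcard : Fintype.card (Fin r ⊕ s) ≤ n := by simpa using hli'.fintype_card_le_finrank
    obtain ⟨V', hV', hxV', hV'V, Y, -, hY, -, hY0, -, hYf, -, -⟩ :=
      hP.exists_dual_functions hV hVU (f := Sum.elim p fun i : s => q i)
        (by
          rintro (i | i)
          · exact (hp i).mono hVU
          · exact hq i i.2)
        (by
          rintro (i | i) (j | j)
          · exact ⟨0, fun x hx => hpp i j x (hVU hx)⟩
          · exact ⟨-if (j : Fin r) = i then 1 else 0, fun x hx => by
              rw [hP.pbrak_swap (hVU hx)]; exact congrArg Neg.neg (hqp x hx j j.2 i)⟩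
          · exact ⟨_, fun x hx => hqp x hx i i.2 j⟩
          · exact ⟨0, fun x hx => hqq x hx i i.2 j j.2⟩) hxV hli'
        (Nat.sub_add_cancel hcard)
    have hqa : Function.update q a (Y (Sum.inl a)) a = Y (Sum.inl a) := Function.update_self ..
    have hqs : ∀ i ∈ s, Function.update q a (Y (Sum.inl a)) i = q i := fun i hi =>
      Function.update_of_ne (fun h : i = a => ha (h ▸ hi)) _ _
    have hYq : ∀ x ∈ V', ∀ i ∈ s, pbrak P (Y (Sum.inl a)) (q i) x = 0 := fun x hx i hi => by
      simpa using hYf x hx (Sum.inl a) (Sum.inr ⟨i, hi⟩)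
    refine ⟨V', hV', hxV', hV'V.trans hVU, Function.update q a (Y (Sum.inl a)), ?_, ?_, ?_, ?_⟩
    · simp only [Finset.forall_mem_insert, hqa]
      exact ⟨hY _, fun i hi => by rw [hqs i hi]; exact (hq i hi).mono hV'V⟩
    · simp only [Finset.forall_mem_insert, hqa]
      exact ⟨hY0 _, fun i hi => by rw [hqs i hi]; exact hq0 i hi⟩
    · intro x hx
      simp only [Finset.forall_mem_insert, hqa]
      refine ⟨fun j => ?_, fun i hi => by rw [hqs i hi]; exact hqp x (hV'V hx) i hi⟩
      simpa using hYf x hx (Sum.inl a) (Sum.inl j)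
    · intro x hx
      have hxU := hVU (hV'V hx)
      simp only [Finset.forall_mem_insert, hqa]
      refine ⟨⟨?_, fun j hj => by rw [hqs j hj]; exact hYq x hx j hj⟩, fun i hi => ?_⟩
      · have := hP.pbrak_swap hxU (Y (Sum.inl a)) (Y (Sum.inl a))
        linarith
      · rw [hqs i hi]
        refine ⟨?_, fun j hj => by rw [hqs j hj]; exact hqq x (hV'V hx) i hi j hj⟩
        rw [hP.pbrak_swap hxU, hYq x hx i hi, neg_zero]

end CanonicalFunctions

section NormalForm

variable {n : ℕ} {P : (Fin n → ℝ) → Matrix (Fin n) (Fin n) ℝ} {U : Set (Fin n → ℝ)}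

theorem IsPoissonMatrix.fderiv_ham_eq_zero (hP : IsPoissonMatrix P U) {x : Fin n → ℝ} (hx : x ∈ U)
    {f : (Fin n → ℝ) → ℝ} (hf : ham P f x = 0) (ξ : Fin n → ℝ) :
    fderiv ℝ f x ((P x).mulVec ξ) = 0 := by
  have h : fderiv ℝ f x ((P x).mulVec ξ) = -∑ j, ξ j * ham P f x j := by
    rw [fderiv_apply_eq_sum_pd]
    simp only [Matrix.mulVec, dotProduct, ham, Finset.sum_mul, Finset.mul_sum]
    rw [Finset.sum_comm, ← Finset.sum_neg_distrib]
    refine Finset.sum_congr rfl fun j _ => ?_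
    rw [← Finset.sum_neg_distrib]
    refine Finset.sum_congr rfl fun i _ => ?_
    rw [hP.2.1 x hx i j]
    ring
  rw [h, hf]
  simp

/-- At a point where `p, q` are canonical and `p, q, Z` have independent differentials, the Poisson
matrix has the minimal rank `2 * r` exactly when all brackets of the functions `Z` vanish. -/
theorem IsPoissonMatrix.rank_eq_iff (hP : IsPoissonMatrix P U) {x : Fin n → ℝ} (hx : x ∈ U)
    {r k : ℕ} {p q : Fin r → (Fin n → ℝ) → ℝ} {Z : Fin k → (Fin n → ℝ) → ℝ}
    (hpp : ∀ i j, pbrak P (p i) (p j) x = 0)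
    (hqp : ∀ i j, pbrak P (q i) (p j) x = if i = j then 1 else 0)
    (hqq : ∀ i j, pbrak P (q i) (q j) x = 0)
    (hqZ : ∀ i l, pbrak P (q i) (Z l) x = 0) (hpZ : ∀ i l, pbrak P (p i) (Z l) x = 0)
    (hli : LinearIndependent ℝ fun a => ham P (Sum.elim p q a) x)
    (hinj : ∀ w, (∀ i, fderiv ℝ (p i) x w = 0) → (∀ i, fderiv ℝ (q i) x w = 0) →
      (∀ l, fderiv ℝ (Z l) x w = 0) → w = 0) :
    (P x).rank = 2 * r ↔ ∀ l m, pbrak P (Z l) (Z m) x = 0 := by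
  have hpq : ∀ i j, pbrak P (p i) (q j) x = if i = j then -1 else 0 := fun i j => by
    rw [hP.pbrak_swap hx, hqp]
    simp only [eq_comm (a := j)]
    split_ifs <;> simp
  have hZp : ∀ l i, pbrak P (Z l) (p i) x = 0 := fun l i => by
    rw [hP.pbrak_swap hx, hpZ, neg_zero]
  have hZq : ∀ l i, pbrak P (Z l) (q i) x = 0 := fun l i => by
    rw [hP.pbrak_swap hx, hqZ, neg_zero]
  let S := Submodule.span ℝ (Set.range fun a => ham P (Sum.elim p q a) x)
  have hS : Module.finrank ℝ S = 2 * r := by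
    rw [finrank_span_eq_card hli, Fintype.card_sum, Fintype.card_fin, two_mul]
  have hham : ∀ f, ham P f x ∈ LinearMap.range (P x).mulVecLin := fun f =>
    ⟨fun j => pd j f x, rfl⟩
  have hSle : S ≤ LinearMap.range (P x).mulVecLin := by
    rw [Submodule.span_le]
    rintro _ ⟨a, rfl⟩
    exact hham _
  constructor
  · intro hrank
    have hSeq : S = LinearMap.range (P x).mulVecLin :=
      Submodule.eq_of_le_of_finrank_eq hSle (hS.trans hrank.symm)
    intro l m
    obtain ⟨a, ha⟩ := Submodule.mem_span_range_iff_exists_fun ℝ |>.1 (hSeq ▸ hham (Z m) : _ ∈ S)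
    rw [Fintype.sum_sum_type] at ha
    rw [pbrak_eq_fderiv_ham, ← ha]
    simp [← pbrak_eq_fderiv_ham, hZp, hZq]
  · intro hZZ
    have hZ0 : ∀ m, ham P (Z m) x = 0 := fun m => hinj _
      (fun i => by rw [← pbrak_eq_fderiv_ham, hpZ]) (fun i => by rw [← pbrak_eq_fderiv_ham, hqZ])
      (fun l => by rw [← pbrak_eq_fderiv_ham, hZZ])
    have hle : LinearMap.range (P x).mulVecLin ≤ S := by
      rintro _ ⟨ξ, rfl⟩
      rw [Matrix.mulVecLin_apply]
      set w := (P x).mulVec ξ with hw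
      have hw0 : w - (∑ j, fderiv ℝ (q j) x w • ham P (p j) x
          - ∑ j, fderiv ℝ (p j) x w • ham P (q j) x) = 0 := by
        refine hinj _ (fun i => ?_) (fun i => ?_) (fun l => ?_)
        · simp [← pbrak_eq_fderiv_ham, hpp, hpq]
        · simp [← pbrak_eq_fderiv_ham, hqp, hqq]
        · simp only [map_sub, map_sum, map_smul, ← pbrak_eq_fderiv_ham, hZp, hZq, smul_zero,
            Finset.sum_const_zero, sub_zero]
          exact hP.fderiv_ham_eq_zero hx (hZ0 l) ξ
      rw [sub_eq_zero.1 hw0]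
      refine S.sub_mem (S.sum_mem fun j _ => S.smul_mem _ (Submodule.subset_span ⟨Sum.inl j, rfl⟩))
        (S.sum_mem fun j _ => S.smul_mem _ (Submodule.subset_span ⟨Sum.inr j, rfl⟩))
    rw [← hS, le_antisymm hSle hle]
    rfl

/-- Canonical functions `p, q`, completed by functions `Z` coming from a dual system, have
independent differentials. -/
theorem IsPoissonMatrix.eq_zero_of_fderiv_eq_zero (hP : IsPoissonMatrix P U) {x : Fin n → ℝ}
    (hx : x ∈ U) {r k : ℕ} {p q : Fin r → (Fin n → ℝ) → ℝ} {Z : Fin k → (Fin n → ℝ) → ℝ}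
    {Y : Fin r ⊕ Fin r → (Fin n → ℝ) → ℝ}
    (hpp : ∀ i j, pbrak P (p i) (p j) x = 0)
    (hqp : ∀ i j, pbrak P (q i) (p j) x = if i = j then 1 else 0)
    (hqq : ∀ i j, pbrak P (q i) (q j) x = 0)
    (hY : ∀ a b, pbrak P (Y a) (Sum.elim p q b) x = if a = b then 1 else 0)
    (hZ : ∀ l b, pbrak P (Z l) (Sum.elim p q b) x = 0)
    (hinj : ∀ w, (∀ a, fderiv ℝ (Y a) x w = 0) → (∀ l, fderiv ℝ (Z l) x w = 0) → w = 0)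
    {w : Fin n → ℝ} (hpw : ∀ i, fderiv ℝ (p i) x w = 0) (hqw : ∀ i, fderiv ℝ (q i) x w = 0)
    (hZw : ∀ l, fderiv ℝ (Z l) x w = 0) : w = 0 := by
  have hw : w = ∑ b, fderiv ℝ (Y b) x w • ham P (Sum.elim p q b) x := by
    rw [← sub_eq_zero]
    refine hinj _ (fun a => ?_) (fun l => ?_)
    · simp only [map_sub, map_sum, map_smul, ← pbrak_eq_fderiv_ham, hY]
      simp
    · simp only [map_sub, map_sum, map_smul, ← pbrak_eq_fderiv_ham, hZ, hZw]
      simp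
  rw [Fintype.sum_sum_type] at hw
  simp only [Sum.elim_inl, Sum.elim_inr] at hw
  have hinl : ∀ i, fderiv ℝ (Y (Sum.inl i)) x w = 0 := by
    intro i
    have h := hqw i
    rw [hw] at h
    simp only [map_add, map_sum, map_smul, ← pbrak_eq_fderiv_ham, hqp, hqq] at h
    simpa using h
  have hinr : ∀ i, fderiv ℝ (Y (Sum.inr i)) x w = 0 := by
    intro i
    have h := hpw i
    rw [hw] at h
    simp only [map_add, map_sum, map_smul, ← pbrak_eq_fderiv_ham, hpp,
      hP.pbrak_swap hx (p i) (q _), hqp] at h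
    simpa using h
  rw [hw]
  simp [hinl, hinr]

/-- On a ball of a product space, a function with vanishing derivative along the first two factors
only depends on the third variable. -/
theorem eq_of_fderiv_prod_eq_zero {A B C : Type*} [NormedAddCommGroup A] [NormedSpace ℝ A]
    [NormedAddCommGroup B] [NormedSpace ℝ B] [NormedAddCommGroup C] [NormedSpace ℝ C]
    {F : A × B × C → ℝ} {ε : ℝ} (hF : DifferentiableOn ℝ F (Metric.ball 0 ε))
    (hF0 : ∀ y ∈ Metric.ball (0 : A × B × C) ε, ∀ a b, fderiv ℝ F y (a, b, 0) = 0)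
    {y : A × B × C} (hy : y ∈ Metric.ball (0 : A × B × C) ε) : F y = F (0, 0, y.2.2) := by
  obtain ⟨a, b, c⟩ := y
  have hmem : ∀ u : A × B, ∀ c : C, (u.1, u.2, c) ∈ Metric.ball (0 : A × B × C) ε ↔
      u ∈ Metric.ball (0 : A × B) ε ∧ ‖c‖ < ε := by
    rintro ⟨a, b⟩ c
    simp [Prod.norm_def, and_assoc]
  obtain ⟨hab, hc⟩ := (hmem (a, b) c).1 hy
  let J : A × B →L[ℝ] A × B × C := (ContinuousLinearMap.fst ℝ A B).prod
    ((ContinuousLinearMap.snd ℝ A B).prod 0)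
  have hd : ∀ u ∈ Metric.ball (0 : A × B) ε,
      HasFDerivAt (fun u : A × B => F (u.1, u.2, c)) (0 : A × B →L[ℝ] ℝ) u := by
    intro u hu
    have hu' := (hmem u c).2 ⟨hu, hc⟩
    have h1 := (hF.differentiableAt (Metric.isOpen_ball.mem_nhds hu')).hasFDerivAt
    have h2 : HasFDerivAt (fun u : A × B => (u.1, u.2, c)) J u :=
      hasFDerivAt_fst.prodMk (hasFDerivAt_snd.prodMk (hasFDerivAt_const c u))
    refine (h1.comp u h2).congr_fderiv ?_
    ext v
    · exact hF0 _ hu' _ _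
    · exact hF0 _ hu' _ _
  have h0 : (0 : A × B) ∈ Metric.ball (0 : A × B) ε :=
    Metric.mem_ball_self (dist_nonneg.trans_lt hab)
  exact Metric.isOpen_ball.is_const_of_fderiv_eq_zero (convex_ball (0 : A × B) ε).isPreconnected
    (fun u hu => (hd u hu).differentiableAt.differentiableWithinAt)
    (fun u hu => (hd u hu).fderiv) hab h0

end NormalForm

/-- The Carathéodory–Jacobi–Lie theorem for Poisson manifolds, in local coordinates. -/
theorem caratheodory_jacobi_lie {n r : ℕ} (U : Set (Fin n → ℝ)) (hU : IsOpen U)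
    (P : (Fin n → ℝ) → Matrix (Fin n) (Fin n) ℝ) (hP : IsPoissonMatrix P U)
    (x0 : Fin n → ℝ) (hx0 : x0 ∈ U)
    (p : Fin r → (Fin n → ℝ) → ℝ)
    (hps : ∀ i, ContDiffOn ℝ (⊤ : ℕ∞) (p i) U)
    (hp0 : ∀ i, p i x0 = 0)
    (hpinv : ∀ i j, ∀ x ∈ U, pbrak P (p i) (p j) x = 0)
    (hind : LinearIndependent ℝ (fun i => ham P (p i) x0)) :
    ∃ V : Set (Fin n → ℝ), IsOpen V ∧ x0 ∈ V ∧ V ⊆ U ∧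
    ∃ (q : Fin r → (Fin n → ℝ) → ℝ) (z : Fin (n - 2 * r) → (Fin n → ℝ) → ℝ),
      (∀ i, ContDiffOn ℝ (⊤ : ℕ∞) (q i) V) ∧ (∀ k, ContDiffOn ℝ (⊤ : ℕ∞) (z k) V) ∧
      -- (1) `Φ = (p₁,q₁,…,p_r,q_r,z₁,…,z_{n−2r})` is a diffeomorphism from `V` onto an open
      -- subset of `ℝⁿ` with `Φ(x⁰) = 0`
      (let Φ : (Fin n → ℝ) → (Fin r → ℝ) × (Fin r → ℝ) × (Fin (n - 2 * r) → ℝ) :=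
         fun x => (fun i => p i x, fun i => q i x, fun k => z k x)
       Φ x0 = 0 ∧ IsOpen (Φ '' V) ∧ Set.InjOn Φ V ∧ ContDiffOn ℝ (⊤ : ℕ∞) Φ V ∧
       ∃ Ψ : (Fin r → ℝ) × (Fin r → ℝ) × (Fin (n - 2 * r) → ℝ) → (Fin n → ℝ),
         ContDiffOn ℝ (⊤ : ℕ∞) Ψ (Φ '' V) ∧ ∀ x ∈ V, Ψ (Φ x) = x) ∧
      -- (2) the canonical bracket relations hold on `V`
      (∀ x ∈ V, ∀ i j, pbrak P (q i) (p j) x = if i = j then 1 else 0) ∧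
      (∀ x ∈ V, ∀ i j, pbrak P (q i) (q j) x = 0) ∧
      (∀ x ∈ V, ∀ i k, pbrak P (q i) (z k) x = 0) ∧
      (∀ x ∈ V, ∀ i k, pbrak P (p i) (z k) x = 0) ∧
      ∃ (W : Set (Fin (n - 2 * r) → ℝ))
        (g : Fin (n - 2 * r) → Fin (n - 2 * r) → (Fin (n - 2 * r) → ℝ) → ℝ),
        IsOpen W ∧ (0 : Fin (n - 2 * r) → ℝ) ∈ W ∧
        (∀ k l, ContDiffOn ℝ (⊤ : ℕ∞) (g k l) W) ∧
        (∀ x ∈ V, (fun k => z k x) ∈ W) ∧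
        (∀ x ∈ V, ∀ k l, pbrak P (z k) (z l) x = g k l (fun k' => z k' x)) ∧
        -- the rank of `π(x⁰)` is `2r` iff all the `g k l` vanish at `0`
        ((P x0).rank = 2 * r ↔ ∀ k l, g k l 0 = 0) := by
  have hn : (∞ : WithTop ℕ∞) ≠ 0 := by simp
  obtain ⟨V₁, hV₁, hxV₁, hV₁U, q, hq, hq0, hqp, hqq⟩ :=
    hP.exists_conjugate_functions hU hx0 hps hpinv hind Finset.univ
  simp only [Finset.mem_univ, forall_const] at hq hq0 hqp hqq
  have hli := hP.linearIndependent_ham_sumElim hx0 (fun i j => hpinv i j x0 hx0) hind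
    (c := id) Function.injective_id (q := q) (fun i j => hqp x0 hxV₁ i j)
  have hcard : 2 * r ≤ n := by
    have := hli.fintype_card_le_finrank
    simp only [Fintype.card_sum, Fintype.card_fin, Module.finrank_fin_fun] at this
    omega
  obtain ⟨V₂, hV₂, hxV₂, hV₂₁, Y, z, -, hz, -, hz0, hYf, hzf, hinjY⟩ :=
    hP.exists_dual_functions hV₁ hV₁U (f := Sum.elim p q)
      (by
        rintro (i | i)
        · exact (hps i).mono hV₁U
        · exact hq i)
      (by
        rintro (i | i) (j | j)
        · exact ⟨0, fun x hx => hpinv i j x (hV₁U hx)⟩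
        · exact ⟨-if j = i then 1 else 0, fun x hx => by
            rw [hP.pbrak_swap (hV₁U hx)]; exact congrArg Neg.neg (hqp x hx j i)⟩
        · exact ⟨_, fun x hx => hqp x hx i j⟩
        · exact ⟨0, fun x hx => hqq x hx i j⟩) hxV₁ hli (k := n - 2 * r)
      (by simp only [Fintype.card_sum, Fintype.card_fin]; omega)
  have hV₂U : V₂ ⊆ U := hV₂₁.trans hV₁U
  have hzp : ∀ x ∈ V₂, ∀ l i, pbrak P (z l) (p i) x = 0 := fun x hx l i => hzf x hx l (Sum.inl i)
  have hzq : ∀ x ∈ V₂, ∀ l i, pbrak P (z l) (q i) x = 0 := fun x hx l i => hzf x hx l (Sum.inr i)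
  have hpz : ∀ x ∈ V₂, ∀ i l, pbrak P (p i) (z l) x = 0 := fun x hx i l => by
    rw [hP.pbrak_swap (hV₂U hx), hzp x hx, neg_zero]
  have hqz : ∀ x ∈ V₂, ∀ i l, pbrak P (q i) (z l) x = 0 := fun x hx i l => by
    rw [hP.pbrak_swap (hV₂U hx), hzq x hx, neg_zero]
  have hinj : ∀ w, (∀ i, fderiv ℝ (p i) x0 w = 0) → (∀ i, fderiv ℝ (q i) x0 w = 0) →
      (∀ l, fderiv ℝ (z l) x0 w = 0) → w = 0 := fun w h1 h2 h3 =>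
    hP.eq_zero_of_fderiv_eq_zero hx0 (fun i j => hpinv i j x0 hx0) (hqp x0 hxV₁) (hqq x0 hxV₁)
      (hYf x0 hxV₂) (hzf x0 hxV₂) hinjY h1 h2 h3
  have hp₂ : ∀ i, ContDiffOn ℝ ∞ (p i) V₂ := fun i => (hps i).mono hV₂U
  have hq₂ : ∀ i, ContDiffOn ℝ ∞ (q i) V₂ := fun i => (hq i).mono hV₂₁
  let Φ : (Fin n → ℝ) → (Fin r → ℝ) × (Fin r → ℝ) × (Fin (n - 2 * r) → ℝ) :=
    fun x => (fun i => p i x, fun i => q i x, fun k => z k x)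
  have hΦ : ContDiffOn ℝ ∞ Φ V₂ := (contDiffOn_pi.2 hp₂).prodMk
    ((contDiffOn_pi.2 hq₂).prodMk (contDiffOn_pi.2 hz))
  have hΦ0 : Φ x0 = 0 :=
    Prod.ext (funext hp0) (Prod.ext (funext hq0) (funext hz0))
  have hΦd : ∀ x ∈ V₂, ∀ w, fderiv ℝ Φ x w = (fun i => fderiv ℝ (p i) x w,
      fun i => fderiv ℝ (q i) x w, fun k => fderiv ℝ (z k) x w) := by
    intro x hx w
    have hd : ∀ {f : (Fin n → ℝ) → ℝ}, ContDiffOn ℝ ∞ f V₂ → HasFDerivAt f (fderiv ℝ f x) x :=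
      fun hf => ((hf.contDiffAt (hV₂.mem_nhds hx)).differentiableAt hn).hasFDerivAt
    have h := (hasFDerivAt_pi.2 fun i => hd (hp₂ i)).prodMk
      ((hasFDerivAt_pi.2 fun i => hd (hq₂ i)).prodMk (hasFDerivAt_pi.2 fun k => hd (hz k)))
    have h' : HasFDerivAt Φ _ x := h
    rw [h'.fderiv]
    rfl
  have hΦinj : Function.Injective (fderiv ℝ Φ x0) := by
    rw [injective_iff_map_eq_zero]
    intro w hw
    rw [hΦd x0 hxV₂] at hw
    exact hinj w (congrFun (congrArg Prod.fst hw))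
      (congrFun (congrArg (fun y => y.2.1) hw)) (congrFun (congrArg (fun y => y.2.2) hw))
  let M : (Fin n → ℝ) ≃L[ℝ] (Fin r → ℝ) × (Fin r → ℝ) × (Fin (n - 2 * r) → ℝ) :=
    (LinearMap.linearEquivOfInjective (fderiv ℝ Φ x0 : _ →ₗ[ℝ] _) hΦinj
      (by simp only [Module.finrank_prod, Module.finrank_fin_fun]; omega)).toContinuousLinearEquiv
  have hM : HasFDerivAt Φ (M : (Fin n → ℝ) →L[ℝ] _) x0 :=
    ((hΦ.contDiffAt (hV₂.mem_nhds hxV₂)).differentiableAt hn).hasFDerivAt.congr_fderiv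
      (ContinuousLinearMap.ext fun _ => rfl)
  obtain ⟨e, heΦ, hx0e, heV₂, hesymm, hinv⟩ :=
    exists_smooth_openPartialHomeomorph hV₂ hΦ hxV₂ M hM
  have h0e : (0 : (Fin r → ℝ) × (Fin r → ℝ) × (Fin (n - 2 * r) → ℝ)) ∈ e.target := by
    rw [← hΦ0, ← heΦ]; exact e.map_source hx0e
  obtain ⟨ε, hε, hball⟩ := Metric.isOpen_iff.1 e.open_target 0 h0e
  let V : Set (Fin n → ℝ) := e.source ∩ Φ ⁻¹' Metric.ball 0 ε
  have hV : IsOpen V := by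
    have := e.isOpen_inter_preimage (Metric.isOpen_ball (x := 0) (ε := ε))
    rwa [heΦ] at this
  have hVV₂ : V ⊆ V₂ := fun x hx => heV₂ hx.1
  have hleft : ∀ x ∈ V, e.symm (Φ x) = x := fun x hx => by rw [← heΦ]; exact e.left_inv hx.1
  have hright : ∀ y ∈ Metric.ball 0 ε, Φ (e.symm y) = y := fun y hy => by
    rw [← heΦ]; exact e.right_inv (hball hy)
  have hsymmV : ∀ y ∈ Metric.ball 0 ε, e.symm y ∈ V := fun y hy =>
    ⟨e.map_target (hball hy), by rw [Set.mem_preimage, hright y hy]; exact hy⟩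
  have himage : Φ '' V = Metric.ball 0 ε := by
    refine Set.Subset.antisymm ?_ fun y hy => ⟨e.symm y, hsymmV y hy, hright y hy⟩
    rintro _ ⟨x, hx, rfl⟩
    exact hx.2
  have hxV : x0 ∈ V := ⟨hx0e, by rw [Set.mem_preimage, hΦ0]; exact Metric.mem_ball_self hε⟩
  have hzz : ∀ l m, ContDiffOn ℝ ∞ (pbrak P (z l) (z m)) V₂ := fun l m =>
    hP.contDiffOn_pbrak hV₂ hV₂U (hz l) (hz m)
  have hzzf : ∀ {f : (Fin n → ℝ) → ℝ}, ContDiffOn ℝ ∞ f V₂ →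
      (∀ x ∈ V₂, ∀ l, pbrak P (z l) f x = 0) → ∀ x ∈ V₂, ∀ l m,
      pbrak P (pbrak P (z l) (z m)) f x = 0 := by
    intro f hf hzf x hx l m
    have hJ := hP.jacobi hV₂ hV₂U (hz l) (hz m) hf hx
    rw [pbrak_eq_zero_of_eqOn_const hV₂ hx (f := pbrak P (z m) f)
        (fun y hy => hzf y hy m),
      pbrak_eq_zero_of_eqOn_const hV₂ hx (f := pbrak P f (z l)) (c := 0) (fun y hy => by
        rw [hP.pbrak_swap (hV₂U hy), hzf y hy, neg_zero])] at hJ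
    simpa using hJ
  let F : Fin (n - 2 * r) → Fin (n - 2 * r) →
      (Fin r → ℝ) × (Fin r → ℝ) × (Fin (n - 2 * r) → ℝ) → ℝ :=
    fun l m y => pbrak P (z l) (z m) (e.symm y)
  have hF : ∀ l m, ContDiffOn ℝ ∞ (F l m) (Metric.ball 0 ε) := fun l m =>
    (hzz l m).comp (hesymm.mono hball) fun y hy => hVV₂ (hsymmV y hy)
  have hF0 : ∀ l m, ∀ y ∈ Metric.ball 0 ε, ∀ a b, fderiv ℝ (F l m) y (a, b, 0) = 0 := by
    intro l m y hy a b
    have hxV' := hsymmV y hy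
    have hxV₂' := hVV₂ hxV'
    have hxV₁' := hV₂₁ hxV₂'
    set x := e.symm y with hx
    have h1 := ((hesymm.contDiffAt (e.open_target.mem_nhds (hball hy))).differentiableAt
      hn).hasFDerivAt
    have h2 := (((hzz l m).contDiffAt (hV₂.mem_nhds hxV₂')).differentiableAt hn).hasFDerivAt
    have h3 : HasFDerivAt (F l m) _ y := h2.comp y h1
    have h4 : fderiv ℝ Φ x (∑ i, b i • ham P (p i) x - ∑ i, a i • ham P (q i) x) = (a, b, 0) := by
      rw [hΦd x hxV₂']
      simp only [map_sub, map_sum, map_smul, ← pbrak_eq_fderiv_ham, hzp x hxV₂', hzq x hxV₂',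
        hqp x hxV₁', hqq x hxV₁', hpinv _ _ x (hV₂U hxV₂'),
        hP.pbrak_swap (hV₂U hxV₂') (p _) (q _)]
      refine Prod.ext ?_ (Prod.ext ?_ ?_) <;> ext <;> simp
    have h5 := hinv x hxV'.1 (∑ i, b i • ham P (p i) x - ∑ i, a i • ham P (q i) x)
    rw [h4, hright y hy] at h5
    rw [h3.fderiv, ContinuousLinearMap.comp_apply, h5]
    simp only [map_sub, map_sum, map_smul, ← pbrak_eq_fderiv_ham,
      hzzf (hp₂ _) (fun x hx l => hzp x hx l _) x hxV₂',
      hzzf (hq₂ _) (fun x hx l => hzq x hx l _) x hxV₂']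
    simp
  have hzW : ∀ x ∈ V, (fun k => z k x) ∈ Metric.ball (0 : Fin (n - 2 * r) → ℝ) ε := by
    intro x hx
    have := hx.2
    rw [Set.mem_preimage, mem_ball_zero_iff] at this
    rw [mem_ball_zero_iff]
    exact ((norm_snd_le (Φ x).2).trans (norm_snd_le (Φ x))).trans_lt this
  have hg : ∀ x ∈ V, ∀ k l, pbrak P (z k) (z l) x = F k l (0, 0, fun k' => z k' x) := by
    intro x hx k l
    have := eq_of_fderiv_prod_eq_zero ((hF k l).differentiableOn hn) (hF0 k l) hx.2
    rw [← this]
    change _ = pbrak P (z k) (z l) (e.symm (Φ x))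
    rw [hleft x hx]
  refine ⟨V, hV, hxV, hVV₂.trans hV₂U, q, z, fun i => (hq₂ i).mono hVV₂,
    fun k => (hz k).mono hVV₂, ⟨hΦ0, ?_, ?_, hΦ.mono hVV₂, e.symm, ?_, hleft⟩,
    fun x hx => hqp x (hV₂₁ (hVV₂ hx)), fun x hx => hqq x (hV₂₁ (hVV₂ hx)),
    fun x hx => hqz x (hVV₂ hx), fun x hx => hpz x (hVV₂ hx),
    Metric.ball 0 ε, fun k l c => F k l (0, 0, c), Metric.isOpen_ball,
    Metric.mem_ball_self hε, fun k l => ?_, hzW, hg, ?_⟩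
  · exact himage ▸ Metric.isOpen_ball
  · exact fun x hx y hy hxy => by rw [← hleft x hx, ← hleft y hy]; exact congrArg e.symm hxy
  · exact hesymm.mono (himage.subset.trans hball)
  · refine (hF k l).comp (contDiff_const.prodMk
      (contDiff_const.prodMk contDiff_id)).contDiffOn fun c hc => ?_
    rw [mem_ball_zero_iff] at hc ⊢
    simpa [Prod.norm_def] using hc
  · rw [hP.rank_eq_iff hx0 (fun i j => hpinv i j x0 hx0) (hqp x0 hxV₁) (hqq x0 hxV₁)
      (hqz x0 hxV₂) (hpz x0 hxV₂) hli hinj]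
    have h0 : (fun k' => z k' x0) = 0 := funext hz0
    simp only [hg x0 hxV, h0]
end

section
/- Let U ⊆ ℝⁿ be open, let π be a Poisson matrix on U such that rank π(x) ≤ 2r for all x ∈ U, and let Y: U → ℝⁿ be a smooth vector field such that (i) Y is a Poisson vector field, i.e. (L_Y π)^{ik} = 0 on U for all i,k, and (ii) Y is tangent to the symplectic leaves, i.e. for every x ∈ U the vector Y(x) lies in the column space (image) of the matrix π(x). Then, for every point m ∈ U with rank π(m) = 2r, there exist an open set V with m ∈ V ⊆ U and a smooth function h: V → ℝ such that Y = X_h on V, i.e. Y^i(x) = Σ_j π^{ij}(x) ∂h/∂x_j(x) for all x ∈ V and all i. -/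
/-- The Lie derivative `L_Y P` of an antisymmetric matrix field `P` along a vector field `Y`. -/
noncomputable def lieDer {n : ℕ} (Y : (Fin n → ℝ) → (Fin n → ℝ))
    (P : (Fin n → ℝ) → Matrix (Fin n) (Fin n) ℝ) (x : Fin n → ℝ) :
    Matrix (Fin n) (Fin n) ℝ :=
  Matrix.of fun i k =>
    ∑ l, (Y x l * pd l (fun y => P y i k) x
      - P x l k * pd l (fun y => Y y i) x
      - P x i l * pd l (fun y => Y y k) x)

open scoped ContDiff Topology unitInterval

universe u

section

/-- Pointwise application of a continuous family of operators, as a bilinear map. -/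
noncomputable def ContinuousMap.applyL (X : Type*) [TopologicalSpace X] [CompactSpace X]
    (E F : Type*) [NormedAddCommGroup E] [NormedSpace ℝ E]
    [NormedAddCommGroup F] [NormedSpace ℝ F] :
    C(X, E →L[ℝ] F) →L[ℝ] C(X, E) →L[ℝ] C(X, F) :=
  LinearMap.mkContinuous₂
    (LinearMap.mk₂ ℝ (fun (A : C(X, E →L[ℝ] F)) (v : C(X, E)) =>
        (⟨fun t => A t (v t), by fun_prop⟩ : C(X, F)))
      (fun A B v => by ext t; simp) (fun c A v => by ext t; simp)
      (fun A v w => by ext t; simp) (fun c A v => by ext t; simp))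
    1 (fun A v => by
      rw [one_mul, ContinuousMap.norm_le _ (by positivity)]
      intro t
      exact (A t).le_of_opNorm_le_of_le (A.norm_coe_le_norm t) (v.norm_coe_le_norm t))

variable {X : Type*} [TopologicalSpace X] [CompactSpace X]

@[simp]
lemma ContinuousMap.applyL_apply {E F : Type*} [NormedAddCommGroup E] [NormedSpace ℝ E]
    [NormedAddCommGroup F] [NormedSpace ℝ F] (A : C(X, E →L[ℝ] F)) (v : C(X, E)) (t : X) :
    ContinuousMap.applyL X E F A v t = A t (v t) := rfl

/-- The superposition operator `γ ↦ f ∘ γ` of a `C¹` map is differentiable. -/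
lemma hasFDerivAt_continuousMap_comp {E F : Type*} [NormedAddCommGroup E] [NormedSpace ℝ E]
    [NormedAddCommGroup F] [NormedSpace ℝ F] {f : E → F} {f' : E → E →L[ℝ] F}
    (hf' : Continuous f') (hf : ∀ x, HasFDerivAt f (f' x) x) (hc : Continuous f) (γ : C(X, E)) :
    HasFDerivAt (fun γ : C(X, E) => (⟨f, hc⟩ : C(E, F)).comp γ)
      (ContinuousMap.applyL X E F ((⟨f', hf'⟩ : C(E, E →L[ℝ] F)).comp γ)) γ := by
  rw [hasFDerivAt_iff_isLittleO_nhds_zero, Asymptotics.isLittleO_iff]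
  intro ε hε
  have hcont : ContinuousAt (fun δ : C(X, E) =>
      (⟨f', hf'⟩ : C(E, E →L[ℝ] F)).comp (γ + δ)) 0 :=
    ((ContinuousMap.continuous_postcomp _).comp (by fun_prop)).continuousAt
  obtain ⟨r, hr, hball⟩ := Metric.eventually_nhds_iff.1
    (hcont.eventually_mem
      (Metric.ball_mem_nhds ((⟨f', hf'⟩ : C(E, E →L[ℝ] F)).comp (γ + 0)) hε))
  filter_upwards [Metric.ball_mem_nhds 0 hr] with η hη
  rw [ContinuousMap.norm_le _ (by positivity)]
  intro t
  have key : ∀ z ∈ segment ℝ (γ t) (γ t + η t), ‖f' z - f' (γ t)‖ ≤ ε := by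
    intro z hz
    rw [segment_eq_image'] at hz
    obtain ⟨θ, hθ, rfl⟩ := hz
    have h1 : dist (θ • η) 0 < r := by
      rw [dist_zero_right, norm_smul, Real.norm_of_nonneg hθ.1]
      rw [mem_ball_zero_iff] at hη
      nlinarith [norm_nonneg η, hθ.2]
    have h2 := (Metric.mem_ball.1 (hball h1)).le
    have h3 := (ContinuousMap.dist_apply_le_dist t).trans h2
    simpa [dist_eq_norm] using h3
  have := (convex_segment (𝕜 := ℝ) (γ t) (γ t + η t)).norm_image_sub_le_of_norm_hasFDerivWithin_le'
    (fun z _ => (hf z).hasFDerivWithinAt) key (left_mem_segment ℝ _ _) (right_mem_segment ℝ _ _)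
  simp only [add_sub_cancel_left] at this
  refine le_trans ?_ (this.trans (by gcongr; exact η.norm_coe_le_norm t))
  simp

/-- The superposition operator `γ ↦ f ∘ γ` of a smooth map is smooth. -/
lemma contDiff_continuousMap_comp {E F : Type u} [NormedAddCommGroup E] [NormedSpace ℝ E]
    [NormedAddCommGroup F] [NormedSpace ℝ F] {f : E → F}
    (hf : ContDiff ℝ ∞ f) :
    ContDiff ℝ ∞ (fun γ : C(X, E) => (⟨f, hf.continuous⟩ : C(E, F)).comp γ) := by
  rw [contDiff_infty]
  intro n
  induction n generalizing F with
  | zero => exact contDiff_zero.2 (ContinuousMap.continuous_postcomp _)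
  | succ n ih =>
    have hf' : ContDiff ℝ ∞ (fderiv ℝ f) := hf.fderiv_right (by simp)
    exact contDiff_succ_iff_hasFDerivAt.2
      ⟨fun γ => ContinuousMap.applyL X E F ((⟨_, hf'.continuous⟩ : C(E, E →L[ℝ] F)).comp γ),
        (ih hf').continuousLinearMap_comp (ContinuousMap.applyL X E F),
        fun γ => hasFDerivAt_continuousMap_comp hf'.continuous
          (fun x => (hf.differentiable (by simp) x).hasFDerivAt) hf.continuous γ⟩

/-- Integration from `0` as an operator on continuous functions on the unit interval. -/
noncomputable def volterra (E : Type*) [NormedAddCommGroup E] [NormedSpace ℝ E] :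
    C(I, E) →L[ℝ] C(I, E) :=
  LinearMap.mkContinuous
    { toFun := fun f => ⟨fun s => ∫ τ in (0 : ℝ)..s, Set.IccExtend zero_le_one f τ, by
        have : Continuous fun s : ℝ => ∫ τ in (0 : ℝ)..s, Set.IccExtend zero_le_one f τ :=
          intervalIntegral.continuous_primitive
            (fun a b => f.continuous.Icc_extend'.intervalIntegrable a b) 0
        fun_prop⟩
      map_add' := fun f g => by
        ext s
        exact intervalIntegral.integral_add (f.continuous.Icc_extend'.intervalIntegrable _ _)
          (g.continuous.Icc_extend'.intervalIntegrable _ _)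
      map_smul' := fun c f => by
        ext s
        exact intervalIntegral.integral_smul c _ }
    1 (fun f => by
      rw [one_mul, ContinuousMap.norm_le _ (norm_nonneg f)]
      intro s
      refine (intervalIntegral.norm_integral_le_of_norm_le_const (C := ‖f‖)
        fun τ _ => f.norm_coe_le_norm _).trans ?_
      rw [sub_zero, abs_of_nonneg s.2.1]
      exact mul_le_of_le_one_right (norm_nonneg f) s.2.2)

lemma volterra_apply {E : Type*} [NormedAddCommGroup E] [NormedSpace ℝ E] (f : C(I, E)) (s : I) :
    volterra E f s = ∫ τ in (0 : ℝ)..s, Set.IccExtend zero_le_one f τ := rfl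

lemma norm_volterra_le {E : Type*} [NormedAddCommGroup E] [NormedSpace ℝ E] (f : C(I, E)) :
    ‖volterra E f‖ ≤ ‖f‖ := by
  simpa using (volterra E).le_of_opNorm_le (LinearMap.mkContinuous_norm_le _ zero_le_one _) f
end

/-- Implicit function theorem for a smooth equation: the implicit function is smooth near the
base point. -/
lemma exists_implicitFunction_contDiffAt {E₁ E₂ F : Type*}
    [NormedAddCommGroup E₁] [NormedSpace ℝ E₁] [CompleteSpace E₁]
    [NormedAddCommGroup E₂] [NormedSpace ℝ E₂] [CompleteSpace E₂]
    [NormedAddCommGroup F] [NormedSpace ℝ F] [CompleteSpace F]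
    {f : E₁ × E₂ → F} (hf : ContDiff ℝ ∞ f) (u : E₁ × E₂)
    (hu : (fderiv ℝ f u ∘L .inr ℝ E₁ E₂).IsInvertible) :
    ∃ G : E₁ → E₂, G u.1 = u.2 ∧ ∀ᶠ x in 𝓝 u.1, f (x, G x) = f u ∧ ContDiffAt ℝ ∞ G x := by
  have hne : (∞ : WithTop ℕ∞) ≠ 0 := by simp
  set G := hf.contDiffAt.implicitFunction hne hu with hG
  have hGu : G u.1 = u.2 := hf.contDiffAt.implicitFunction_apply_self hne hu
  have hGc : ContDiffAt ℝ ∞ G u.1 := hf.contDiffAt.contDiffAt_implicitFunction hne hu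
  have heq : ∀ᶠ x in 𝓝 u.1, f (x, G x) = f u :=
    hf.contDiffAt.eventually_apply_implicitFunction hne hu
  have huniq : ∀ᶠ v in 𝓝 u, f v = f u ↔ G v.1 = v.2 :=
    hf.contDiffAt.eventually_apply_eq_iff_implicitFunction hne hu
  have hinv : ∀ᶠ v in 𝓝 u, (fderiv ℝ f v ∘L .inr ℝ E₁ E₂).IsInvertible := by
    have hc : Continuous fun v => fderiv ℝ f v ∘L .inr ℝ E₁ E₂ :=
      (hf.continuous_fderiv hne).clm_comp continuous_const
    exact (ContinuousLinearEquiv.isOpen.preimage hc).mem_nhds hu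
  have htend : Filter.Tendsto (fun x => (x, G x)) (𝓝 u.1) (𝓝 u) := by
    have := (continuousAt_id.prodMk hGc.continuousAt).tendsto
    simpa [hGu] using this
  refine ⟨G, hGu, ?_⟩
  filter_upwards [heq, htend.eventually hinv, htend.eventually huniq.eventually_nhds]
    with x hx hix hux
  refine ⟨hx, ?_⟩
  set v : E₁ × E₂ := (x, G x)
  have hGc' := (hf.contDiffAt (x := v)).contDiffAt_implicitFunction hne hix
  have hself := (hf.contDiffAt (x := v)).implicitFunction_apply_self hne hix
  refine hGc'.congr_of_eventuallyEq ?_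
  have htend' : Filter.Tendsto (fun y => (y, hf.contDiffAt.implicitFunction hne hix y))
      (𝓝 v.1) (𝓝 v) := by
    have := (continuousAt_id.prodMk hGc'.continuousAt).tendsto
    rw [hself] at this
    exact this
  filter_upwards [htend'.eventually hux,
    hf.contDiffAt.eventually_apply_implicitFunction hne hix] with y hy hy'
  exact hy.1 (hy'.trans hx)

/-- A function smooth near a point agrees near this point with a globally smooth function. -/
lemma exists_contDiff_eventuallyEq {E F : Type*} [NormedAddCommGroup E] [NormedSpace ℝ E]
    [FiniteDimensional ℝ E] [NormedAddCommGroup F] [NormedSpace ℝ F] {f : E → F} {m : E}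
    (hf : ∀ᶠ x in 𝓝 m, ContDiffAt ℝ ∞ f x) :
    ∃ f' : E → F, ContDiff ℝ ∞ f' ∧ f' =ᶠ[𝓝 m] f := by
  obtain ⟨r, hr, hball⟩ := Metric.eventually_nhds_iff_ball.1 hf
  let b : ContDiffBump m := ⟨r / 4, r / 2, by linarith, by linarith⟩
  refine ⟨fun x => b x • f x, ?_, ?_⟩
  · rw [contDiff_iff_contDiffAt]
    intro x
    by_cases hx : x ∈ Metric.ball m r
    · exact b.contDiffAt.smul (hball x hx)
    · have hx' : x ∉ tsupport b := by
        rw [b.tsupport_eq]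
        simp only [Metric.mem_ball, not_lt, Metric.mem_closedBall, not_le] at hx ⊢
        change r / 2 < _
        linarith
      refine (contDiffAt_const (c := (0 : F))).congr_of_eventuallyEq ?_
      filter_upwards [(notMem_tsupport_iff_eventuallyEq.1 hx')] with y hy
      simp [hy]
  · filter_upwards [b.eventuallyEq_one] with x hx
    simp [hx]

section
variable {E T F : Type u} [NormedAddCommGroup E] [NormedSpace ℝ E]
  [NormedAddCommGroup T] [NormedSpace ℝ T] [NormedAddCommGroup F] [NormedSpace ℝ F]

/-- The values along a curve `c` of a field of operators `g`, applied to a fixed vector `w`. -/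
noncomputable def alongCurve (g : C(E, T →L[ℝ] F)) (c : C(I, E)) (w : T) : C(I, F) :=
  ContinuousMap.applyL I T F (g.comp c) (ContinuousLinearMap.const ℝ I w)

@[simp]
lemma alongCurve_apply (g : C(E, T →L[ℝ] F)) (c : C(I, E)) (w : T) (s : I) :
    alongCurve g c w s = g (c s) w := rfl

lemma contDiff_alongCurve {g : E → T →L[ℝ] F} (hg : ContDiff ℝ ∞ g) :
    ContDiff ℝ ∞ fun p : C(I, E) × T => alongCurve ⟨g, hg.continuous⟩ p.1 p.2 :=
  (((ContinuousMap.applyL I T F).contDiff.comp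
    ((contDiff_continuousMap_comp hg).comp contDiff_fst)).clm_apply
    ((ContinuousLinearMap.const ℝ I).contDiff.comp contDiff_snd))

lemma exists_hasFDerivAt_alongCurve {g : E → T →L[ℝ] F} (hg : ContDiff ℝ ∞ g)
    {G : E → C(I, E)} {G' : E →L[ℝ] C(I, E)} {x : E} (hG : HasFDerivAt G G' x)
    (q : E →L[ℝ] T) (m : E) :
    ∃ L : E →L[ℝ] C(I, F),
      HasFDerivAt (fun y => alongCurve ⟨g, hg.continuous⟩ (G y) (q (y - m))) L x ∧
      ∀ v s, L v s = g (G x s) (q v) + fderiv ℝ g (G x s) (G' v s) (q (x - m)) := by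
  have hg' : ContDiff ℝ ∞ (fderiv ℝ g) := hg.fderiv_right (by simp)
  have h1 := (hasFDerivAt_continuousMap_comp hg'.continuous
    (fun x => (hg.differentiable (by simp) x).hasFDerivAt) hg.continuous (G x)).comp x hG
  have h2 : HasFDerivAt (fun y => ContinuousLinearMap.const ℝ I (q (y - m)))
      ((ContinuousLinearMap.const ℝ I).comp q) x :=
    ((ContinuousLinearMap.const ℝ I).comp q).hasFDerivAt.comp x
      ((hasFDerivAt_id x).sub_const m)
  refine ⟨_, (ContinuousMap.applyL I T F).hasFDerivAt_of_bilinear h1 h2, fun v s => ?_⟩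
  simp [ContinuousLinearMap.precompR, ContinuousLinearMap.precompL]

/-- Smooth dependence on `x` of the curve which starts at `x` and follows the vector field
`-Z (q (x - m))` up to time one. -/
lemma exists_contDiffAt_integralCurve [CompleteSpace E] {Z : E → T →L[ℝ] E}
    (hZ : ContDiff ℝ ∞ Z) (q : E →L[ℝ] T) (m : E) :
    ∃ G : E → C(I, E), G m = .const I m ∧ ∀ᶠ x in 𝓝 m, ContDiffAt ℝ ∞ G x ∧
      G x = .const I x - volterra E (alongCurve ⟨Z, hZ.continuous⟩ (G x) (q (x - m))) := by
  set f : E × C(I, E) → C(I, E) := fun p => p.2 - ContinuousLinearMap.const ℝ I p.1 +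
    volterra E (alongCurve ⟨Z, hZ.continuous⟩ p.2 (q (p.1 - m))) with hf_def
  have hf : ContDiff ℝ ∞ f := by
    refine (contDiff_snd.sub ((ContinuousLinearMap.const ℝ I).contDiff.comp contDiff_fst)).add
      ((volterra E).contDiff.comp ((contDiff_alongCurve hZ).comp
        (contDiff_snd.prodMk (q.contDiff.comp (contDiff_fst.sub contDiff_const)))))
  have hfm : ∀ γ, f (m, γ) = γ - .const I m := by
    intro γ
    ext s
    simp [hf_def, volterra_apply]
    rw [intervalIntegral.integral_congr (g := fun _ => 0)]
    · simp
    · intro t _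
      simp [Set.IccExtend]
  have hd : fderiv ℝ f (m, .const I m) ∘L .inr ℝ E C(I, E) = .id ℝ _ := by
    have h1 : HasFDerivAt (fun γ => f (m, γ))
        (fderiv ℝ f (m, .const I m) ∘L .inr ℝ E C(I, E)) (.const I m) :=
      ((hf.differentiable (by simp) (m, .const I m)).hasFDerivAt).comp _
        (hasFDerivAt_prodMk_right m _)
    have h2 : HasFDerivAt (fun γ => f (m, γ)) (.id ℝ _) (.const I m) := by
      simp only [hfm]
      exact (hasFDerivAt_id _).sub_const _
    exact h1.unique h2
  obtain ⟨G, hGm, hG⟩ := exists_implicitFunction_contDiffAt hf (m, .const I m)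
    (by rw [hd]; exact ⟨.refl ℝ _, rfl⟩)
  refine ⟨G, hGm, ?_⟩
  filter_upwards [hG] with x hx
  refine ⟨hx.2, ?_⟩
  have h := hx.1
  rw [hfm, sub_self] at h
  rw [eq_sub_iff_add_eq, ← sub_eq_zero, ← h, add_sub_right_comm]
  rfl

lemma hasDerivAt_of_eq_sub_volterra [CompleteSpace E] {c v : C(I, E)} {x : E}
    (hc : c = .const I x - volterra E v) {s : ℝ} (hs : s ∈ Set.Ioo (0 : ℝ) 1) :
    HasDerivAt (Set.IccExtend zero_le_one c) (-Set.IccExtend zero_le_one v s) s := by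
  have hv : Continuous (Set.IccExtend (zero_le_one (α := ℝ)) v) := v.continuous.Icc_extend'
  have h := (intervalIntegral.integral_hasDerivAt_right (hv.intervalIntegrable 0 s)
    (hv.stronglyMeasurableAtFilter _ _) hv.continuousAt).const_sub x
  refine h.congr_of_eventuallyEq ?_
  filter_upwards [Icc_mem_nhds hs.1 hs.2] with r hr
  rw [Set.IccExtend_of_mem _ _ hr, hc]
  rfl

/-- Along an integral curve `c` of `-Z w`, integrate the derivative of `s ↦ (1 - s) • g (c s) ξ`. -/
lemma one_sub_smul_alongCurve_eq [CompleteSpace E] [CompleteSpace F] {Z : E → T →L[ℝ] E}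
    (hZ : Continuous Z) {g : E → T →L[ℝ] F} (hg : ContDiff ℝ ∞ g) {c : C(I, E)} {x : E} {w : T}
    (hc : c = .const I x - volterra E (alongCurve ⟨Z, hZ⟩ c w))
    (hsymm : ∀ s ξ η, fderiv ℝ g (c s) (Z (c s) ξ) η = fderiv ℝ g (c s) (Z (c s) η) ξ)
    (ξ : T) (f : C(I, F)) (hf : ∀ s : I, f s = g (c s) ξ +
      fderiv ℝ g (c s) ((1 - (s : ℝ)) • Z (c s) ξ) w) (s : I) :
    (1 - (s : ℝ)) • g (c s) ξ = g x ξ - volterra F f s := by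
  have hc0 : c 0 = x := by
    rw [hc]
    simp [volterra_apply]
  have hcc : Continuous (Set.IccExtend (zero_le_one (α := ℝ)) c) := c.continuous.Icc_extend'
  have key := intervalIntegral.integral_eq_sub_of_hasDerivAt_of_le
    (f := fun r : ℝ => (1 - r) • g (Set.IccExtend zero_le_one c r) ξ)
    (f' := fun r => -Set.IccExtend zero_le_one f r) s.2.1
    (by have := hg.continuous; fun_prop)
    (fun r hr => by
      have hr1 : r ∈ Set.Ioo (0 : ℝ) 1 := ⟨hr.1, hr.2.trans_le s.2.2⟩
      have hr2 : r ∈ Set.Icc (0 : ℝ) 1 := ⟨hr1.1.le, hr1.2.le⟩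
      have h1 := hasDerivAt_of_eq_sub_volterra hc hr1
      have h2 := ((hg.differentiable (by simp) _).hasFDerivAt.comp_hasDerivAt r h1).clm_apply
        (hasDerivAt_const r ξ)
      have h3 := ((hasDerivAt_id r).const_sub 1).smul h2
      convert! h3 using 1
      simp only [Set.IccExtend_of_mem _ _ hr2, hf]
      simp [Set.IccExtend_of_mem _ _ hr2, hsymm _ w ξ, add_comm])
    (f.continuous.Icc_extend'.neg.intervalIntegrable _ _)
  rw [intervalIntegral.integral_neg] at key
  rw [volterra_apply, sub_eq_add_neg (g x ξ), key]
  have hs : Set.IccExtend (zero_le_one (α := ℝ)) c s = c s := by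
    rw [Set.IccExtend_of_mem _ _ s.2]
  simp [hc0, hs]

/-- Given a commuting frame `Z` of vector fields admitting linear coordinates `q` along it, a
family `g` of functions satisfying the integrability condition is locally the family of
derivatives of a smooth function along the frame. -/
theorem exists_local_potential [CompleteSpace E] [CompleteSpace F] {Z : E → T →L[ℝ] E}
    (hZ : ContDiff ℝ ∞ Z) {g : E → T →L[ℝ] F} (hg : ContDiff ℝ ∞ g) (q : E →L[ℝ] T) (m : E)
    (hq : ∀ᶠ x in 𝓝 m, ∀ ξ, q (Z x ξ) = ξ)
    (hZs : ∀ᶠ x in 𝓝 m, ∀ ξ η, fderiv ℝ Z x (Z x ξ) η = fderiv ℝ Z x (Z x η) ξ)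
    (hgs : ∀ᶠ x in 𝓝 m, ∀ ξ η, fderiv ℝ g x (Z x ξ) η = fderiv ℝ g x (Z x η) ξ) :
    ∃ h : E → F, ∀ᶠ x in 𝓝 m, ContDiffAt ℝ ∞ h x ∧ ∀ ξ, fderiv ℝ h x (Z x ξ) = g x ξ := by
  obtain ⟨G, hGm, hG⟩ := exists_contDiffAt_integralCurve hZ q m
  set K : ℝ := ‖fderiv ℝ Z m‖ + 1
  have hK : ∀ᶠ y in 𝓝 m, ‖fderiv ℝ Z y‖ < K :=
    (hZ.continuous_fderiv (by simp)).norm.continuousAt.eventually_lt continuousAt_const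
      (lt_add_one _)
  obtain ⟨r, hr, hball⟩ := Metric.eventually_nhds_iff_ball.1 (hZs.and (hgs.and hK))
  have hGr : ∀ᶠ x in 𝓝 m, ∀ s, G x s ∈ Metric.ball m r := by
    have h1 : ContinuousAt G m := hG.self_of_nhds.1.continuousAt
    filter_upwards [h1.eventually_mem (Metric.ball_mem_nhds (G m) hr)] with x hx s
    have := (ContinuousMap.dist_apply_le_dist s).trans_lt (Metric.mem_ball.1 hx)
    simpa [hGm] using this
  have hKw : ∀ᶠ x in 𝓝 m, K * ‖q (x - m)‖ < 1 := by
    have : Continuous fun x => K * ‖q (x - m)‖ := by fun_prop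
    exact this.continuousAt.eventually_lt continuousAt_const (by simp)
  refine ⟨fun x => volterra F (alongCurve ⟨g, hg.continuous⟩ (G x) (q (x - m))) 1, ?_⟩
  filter_upwards [hG.eventually_nhds, hGr, hKw, hq] with x hGx hGrx hKx hqx
  have hGd := hGx.self_of_nhds.1
  refine ⟨?_, fun ξ => ?_⟩
  · exact (ContinuousMap.evalCLM ℝ (1 : I)).contDiff.contDiffAt.comp x
      ((volterra F).contDiff.contDiffAt.comp x ((contDiff_alongCurve hg).contDiffAt.comp x
        (hGd.prodMk (q.contDiff.contDiffAt.comp x (contDiffAt_id.sub contDiffAt_const)))))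
  have hG' := (hGd.differentiableAt (by simp)).hasFDerivAt
  set G' := fderiv ℝ G x
  set w := q (x - m)
  have hc := hGx.self_of_nhds.2
  set c := G x
  obtain ⟨L, hL, hLv⟩ := exists_hasFDerivAt_alongCurve hZ hG' q m
  obtain ⟨M, hM, hMv⟩ := exists_hasFDerivAt_alongCurve hg hG' q m
  have hδ : G' (Z x ξ) = .const I (Z x ξ) - volterra E (L (Z x ξ)) := by
    have h1 : HasFDerivAt G (ContinuousLinearMap.const ℝ I - (volterra E).comp L) x :=
      ((ContinuousLinearMap.const ℝ I).hasFDerivAt.sub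
        ((volterra E).hasFDerivAt.comp x hL)).congr_of_eventuallyEq
        (hGx.mono fun y hy => hy.2)
    rw [show G' = _ from hG'.unique h1]
    rfl
  have hZc := hZ.continuous
  have hZ'c := hZ.continuous_fderiv (by simp)
  let ε : C(I, E) := ⟨fun s => (1 - (s : ℝ)) • Z (c s) ξ, by fun_prop⟩
  let f : C(I, E) := ⟨fun s => Z (c s) ξ + fderiv ℝ Z (c s) (ε s) w, by fun_prop⟩
  have hε : ε = .const I (Z x ξ) - volterra E f := by
    ext s
    exact one_sub_smul_alongCurve_eq hZc hZ hc (fun s => (hball _ (hGrx s)).1) ξ f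
      (fun s => rfl) s
  have hδε : G' (Z x ξ) = ε := by
    have h1 : G' (Z x ξ) - ε = volterra E (f - L (Z x ξ)) := by
      rw [map_sub]
      nth_rw 1 [hδ, hε]
      abel
    have h2 : ‖f - L (Z x ξ)‖ ≤ K * ‖w‖ * ‖G' (Z x ξ) - ε‖ := by
      rw [ContinuousMap.norm_le _ (by positivity)]
      intro s
      have h3 : (f - L (Z x ξ)) s = -fderiv ℝ Z (c s) ((G' (Z x ξ) - ε) s) w := by
        change Z (c s) ξ + fderiv ℝ Z (c s) (ε s) w - L (Z x ξ) s =
          -fderiv ℝ Z (c s) (G' (Z x ξ) s - ε s) w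
        rw [hLv, hqx, map_sub (fderiv ℝ Z (c s)), sub_apply]
        change _ + _ - (_ + fderiv ℝ Z (c s) (G' (Z x ξ) s) w) = _
        abel
      rw [h3, norm_neg]
      calc _ ≤ ‖fderiv ℝ Z (c s)‖ * ‖(G' (Z x ξ) - ε) s‖ * ‖w‖ :=
            ContinuousLinearMap.le_opNorm₂ _ _ _
        _ ≤ K * ‖G' (Z x ξ) - ε‖ * ‖w‖ := by
            gcongr
            · exact (hball _ (hGrx s)).2.2.le
            · exact ContinuousMap.norm_coe_le_norm _ s
        _ = _ := by ring
    have h3 := (norm_volterra_le (f - L (Z x ξ))).trans h2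
    rw [← h1] at h3
    rw [← sub_eq_zero, ← norm_le_zero_iff]
    by_contra! h4
    nlinarith
  have hh : HasFDerivAt (fun x => volterra F (alongCurve ⟨g, hg.continuous⟩ (G x) (q (x - m))) 1)
      ((ContinuousMap.evalCLM ℝ (1 : I)).comp ((volterra F).comp M)) x :=
    ((ContinuousMap.evalCLM ℝ (1 : I)).comp (volterra F)).hasFDerivAt.comp x hM
  rw [hh.fderiv]
  have := one_sub_smul_alongCurve_eq hZc hg hc (fun s => (hball _ (hGrx s)).2.1) ξ (M (Z x ξ))
    (fun s => by rw [hMv, hqx, hδε]; rfl) 1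
  simp only [Set.Icc.coe_one, sub_self, zero_smul] at this
  exact (sub_eq_zero.1 this.symm).symm

end

/-- The integrability condition for `g`, expressed through a field of operators `A` whose range is
the span of the frame, and the induced values `b x u = g x (q (A x u))`. -/
lemma fderiv_frame_symm {E T F : Type*} [NormedAddCommGroup E] [NormedSpace ℝ E]
    [NormedAddCommGroup T] [NormedSpace ℝ T] [NormedAddCommGroup F] [NormedSpace ℝ F]
    {A : E → E →L[ℝ] E} {b : E → E →L[ℝ] F} {Z : E → T →L[ℝ] E} {g : E → T →L[ℝ] F}
    (q : E →L[ℝ] T) {x : E} (hA : DifferentiableAt ℝ A x) (hb : DifferentiableAt ℝ b x)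
    (hg : DifferentiableAt ℝ g x) (hgb : ∀ᶠ y in 𝓝 x, ∀ u, g y (q (A y u)) = b y u)
    (hZ : ∀ ξ, ∃ u, A x u = Z x ξ) (hq : ∀ ξ, q (Z x ξ) = ξ)
    (hinv : ∀ u v, ∃ w, fderiv ℝ A x (A x u) v - fderiv ℝ A x (A x v) u = A x w ∧
      fderiv ℝ b x (A x u) v - fderiv ℝ b x (A x v) u = b x w) (ξ η : T) :
    fderiv ℝ g x (Z x ξ) η = fderiv ℝ g x (Z x η) ξ := by
  have key : ∀ v w, fderiv ℝ g x w (q (A x v)) + g x (q (fderiv ℝ A x w v)) =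
      fderiv ℝ b x w v := by
    intro v w
    have h1 : HasFDerivAt (fun y => q (A y v)) _ x :=
      q.hasFDerivAt.comp x (hA.hasFDerivAt.clm_apply (hasFDerivAt_const v x))
    have h2 := hg.hasFDerivAt.clm_apply h1
    have h3 := hb.hasFDerivAt.clm_apply (hasFDerivAt_const v x)
    have heq : (fun y => b y v) =ᶠ[𝓝 x] fun y => g y (q (A y v)) :=
      hgb.mono fun y hy => (hy v).symm
    have h4 := h2.congr_of_eventuallyEq heq
    have h5 := congrArg (fun L : E →L[ℝ] F => L w) (h4.unique h3)
    simpa [add_comm] using h5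
  obtain ⟨u, hu⟩ := hZ ξ
  obtain ⟨v, hv⟩ := hZ η
  obtain ⟨w, hw, hw'⟩ := hinv u v
  have h1 := key v (A x u)
  have h2 := key u (A x v)
  have h3 := hgb.self_of_nhds w
  rw [hv, hq, hu] at h1
  rw [hu, hq, hv] at h2
  rw [hu, hv] at hw hw'
  rw [← hw', ← h1, ← h2, ← hw, map_sub, map_sub] at h3
  rw [← sub_eq_zero]
  have h4 : fderiv ℝ g x (Z x ξ) η - fderiv ℝ g x (Z x η) ξ =
    (fderiv ℝ g x (Z x ξ) η + g x (q (fderiv ℝ A x (Z x ξ) v)) -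
      (fderiv ℝ g x (Z x η) ξ + g x (q (fderiv ℝ A x (Z x η) u)))) -
    (g x (q (fderiv ℝ A x (Z x ξ) v)) - g x (q (fderiv ℝ A x (Z x η) u))) := by abel
  rw [h4, ← h3, sub_self]

/-- Let `A` be a field of operators whose rank is maximal at `m` and whose range is an involutive
distribution. If `b` vanishes on the kernel of `A` and satisfies the corresponding integrability
condition, then near `m` there is a smooth `h` with `dh ∘ A = b`. -/
theorem exists_fderiv_comp_eq {E F : Type u} [NormedAddCommGroup E] [NormedSpace ℝ E]
    [FiniteDimensional ℝ E] [NormedAddCommGroup F] [NormedSpace ℝ F] [CompleteSpace F]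
    {A : E → E →L[ℝ] E} {b : E → E →L[ℝ] F} {m : E}
    (hA : ∀ᶠ x in 𝓝 m, ContDiffAt ℝ ∞ A x) (hb : ∀ᶠ x in 𝓝 m, ContDiffAt ℝ ∞ b x)
    (hrk : ∀ᶠ x in 𝓝 m, Module.finrank ℝ (A x).range ≤ Module.finrank ℝ (A m).range)
    (hker : ∀ᶠ x in 𝓝 m, ∀ u, A x u = 0 → b x u = 0)
    (hinv : ∀ᶠ x in 𝓝 m, ∀ u v, ∃ w,
      fderiv ℝ A x (A x u) v - fderiv ℝ A x (A x v) u = A x w ∧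
      fderiv ℝ b x (A x u) v - fderiv ℝ b x (A x v) u = b x w) :
    ∃ h : E → F, ∀ᶠ x in 𝓝 m, ContDiffAt ℝ ∞ h x ∧ ∀ u, fderiv ℝ h x (A x u) = b x u := by
  have : CompleteSpace E := FiniteDimensional.complete ℝ E
  set T : Submodule ℝ E := (A m).range
  have : CompleteSpace T := FiniteDimensional.complete ℝ T
  obtain ⟨q', hq'⟩ := T.subtype.exists_leftInverse_of_injective T.ker_subtype
  obtain ⟨S', hS'⟩ := (A m).toLinearMap.rangeRestrict.exists_rightInverse_of_surjective
    (LinearMap.range_rangeRestrict _)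
  set q : E →L[ℝ] T := q'.toContinuousLinearMap
  set S : T →L[ℝ] E := S'.toContinuousLinearMap
  set B : E → T →L[ℝ] T := fun x => q ∘L A x ∘L S with hBdef
  have hBm : B m = 1 := by
    ext1 ξ
    have h1 : A m (S ξ) = ξ := congrArg Subtype.val (LinearMap.congr_fun hS' ξ)
    have h2 : q ξ = ξ := LinearMap.congr_fun hq' ξ
    simp [hBdef, h1, h2]
  have hB : ∀ᶠ x in 𝓝 m, ContDiffAt ℝ ∞ B x :=
    hA.mono fun x hx => contDiffAt_const.clm_comp (hx.clm_comp contDiffAt_const)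
  have hBu : ∀ᶠ x in 𝓝 m, IsUnit (B x) := by
    have hU : {L : T →L[ℝ] T | IsUnit L} ∈ 𝓝 (B m) :=
      (Units.isOpen (R := T →L[ℝ] T)).mem_nhds (show IsUnit (B m) by rw [hBm]; exact isUnit_one)
    exact hB.self_of_nhds.continuousAt.eventually_mem hU
  set R : E → T →L[ℝ] E := fun x => S ∘L Ring.inverse (B x) with hRdef
  have hR : ∀ᶠ x in 𝓝 m, ContDiffAt ℝ ∞ R x := by
    filter_upwards [hB, hBu] with x hx hux
    obtain ⟨y, hy⟩ := hux
    have := contDiffAt_ringInverse ℝ (R := T →L[ℝ] T) (n := ∞) y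
    rw [hy] at this
    exact contDiffAt_const.clm_comp (this.comp x hx)
  have hqR : ∀ᶠ x in 𝓝 m, ∀ ξ, q (A x (R x ξ)) = ξ := by
    filter_upwards [hBu] with x hx ξ
    exact congrArg (fun L : T →L[ℝ] T => L ξ) (Ring.mul_inverse_cancel _ hx)
  have hRq : ∀ᶠ x in 𝓝 m, ∀ u, A x (R x (q (A x u))) = A x u := by
    filter_upwards [hqR, hrk] with x hx hrx u
    have hinj : Function.Injective (A x ∘L R x) :=
      Function.LeftInverse.injective (g := q) hx
    have hle : (A x ∘L R x).range ≤ (A x).range := by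
      rintro _ ⟨ξ, rfl⟩
      exact ⟨R x ξ, rfl⟩
    have hfr : Module.finrank ℝ (A x).range ≤ Module.finrank ℝ (A x ∘L R x).range :=
      hrx.trans (LinearMap.finrank_range_of_inj hinj).ge
    have heq := Submodule.eq_of_le_of_finrank_le hle hfr
    obtain ⟨ξ, hξ⟩ : A x u ∈ (A x ∘L R x).range := heq ▸ ⟨u, rfl⟩
    have hξ' : A x (R x ξ) = A x u := hξ
    rw [← hξ', hx]
  have hbR : ∀ᶠ x in 𝓝 m, ∀ u, b x (R x (q (A x u))) = b x u := by
    filter_upwards [hRq, hker] with x hx hkx u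
    rw [← sub_eq_zero, ← map_sub]
    exact hkx _ (by rw [map_sub, hx, sub_self])
  obtain ⟨Z, hZ, hZA⟩ := exists_contDiff_eventuallyEq (f := fun x => A x ∘L R x) (m := m)
    (by filter_upwards [hA, hR] with x h1 h2 using h1.clm_comp h2)
  obtain ⟨g, hg, hgA⟩ := exists_contDiff_eventuallyEq (f := fun x => b x ∘L R x) (m := m)
    (by filter_upwards [hb, hR] with x h1 h2 using h1.clm_comp h2)
  have hqZ : ∀ᶠ x in 𝓝 m, ∀ ξ, q (Z x ξ) = ξ := by
    filter_upwards [hZA, hqR] with x h1 h2 ξ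
    rw [h1]
    exact h2 ξ
  have hZq : ∀ᶠ x in 𝓝 m, ∀ u, Z x (q (A x u)) = A x u := by
    filter_upwards [hZA, hRq] with x h1 h2 u
    rw [h1]
    exact h2 u
  have hgq : ∀ᶠ x in 𝓝 m, ∀ u, g x (q (A x u)) = b x u := by
    filter_upwards [hgA, hbR] with x h1 h2 u
    rw [h1]
    exact h2 u
  have hAZ : ∀ᶠ x in 𝓝 m, ∀ ξ, ∃ u, A x u = Z x ξ := by
    filter_upwards [hZA] with x h1 ξ
    exact ⟨R x ξ, by rw [h1]; rfl⟩
  have hd : (∞ : WithTop ℕ∞) ≠ 0 := by simp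
  obtain ⟨h, hh⟩ := exists_local_potential hZ hg q m hqZ
    (by
      filter_upwards [hA, hZq.eventually_nhds, hAZ, hqZ, hinv] with x h1 h3 h4 h5 h6
      exact fderiv_frame_symm q (h1.differentiableAt hd) (h1.differentiableAt hd)
        (hZ.differentiable hd x) h3 h4 h5
        fun u v => (h6 u v).imp fun w hw => ⟨hw.1, hw.1⟩)
    (by
      filter_upwards [hA, hb, hgq.eventually_nhds, hAZ, hqZ, hinv] with x h1 h2 h3 h4 h5 h6
      exact fderiv_frame_symm q (h1.differentiableAt hd) (h2.differentiableAt hd)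
        (hg.differentiable hd x) h3 h4 h5 h6)
  refine ⟨h, ?_⟩
  filter_upwards [hh, hZq, hgq] with x h1 h2 h3
  refine ⟨h1.1, fun u => ?_⟩
  rw [← h3, ← h1.2, h2]

section Coordinates

variable {n : ℕ}

lemma fderiv_eq_sum_pd (f : (Fin n → ℝ) → ℝ) (x w : Fin n → ℝ) :
    fderiv ℝ f x w = ∑ l, w l * pd l f x := by
  conv_lhs => rw [pi_eq_sum_univ' w]
  simp [pd, map_sum, smul_eq_mul]

/-- A matrix field as a field of operators. -/
noncomputable def matrixFieldCLM (P : (Fin n → ℝ) → Matrix (Fin n) (Fin n) ℝ) (x : Fin n → ℝ) :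
    (Fin n → ℝ) →L[ℝ] (Fin n → ℝ) :=
  (P x).mulVecLin.toContinuousLinearMap

/-- The covector field `u ↦ -⟨Y, u⟩` associated with a vector field `Y`. -/
noncomputable def negDotCLM (Y : (Fin n → ℝ) → (Fin n → ℝ)) (x : Fin n → ℝ) :
    (Fin n → ℝ) →L[ℝ] ℝ :=
  -∑ i, Y x i • ContinuousLinearMap.proj (R := ℝ) (φ := fun _ : Fin n => ℝ) i

lemma matrixFieldCLM_apply (P : (Fin n → ℝ) → Matrix (Fin n) (Fin n) ℝ) (x v : Fin n → ℝ)
    (i : Fin n) : matrixFieldCLM P x v i = ∑ j, P x i j * v j := rfl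

lemma negDotCLM_apply (Y : (Fin n → ℝ) → (Fin n → ℝ)) (x u : Fin n → ℝ) :
    negDotCLM Y x u = -∑ i, Y x i * u i := by
  simp [negDotCLM]

lemma contDiffAt_matrixFieldCLM {P : (Fin n → ℝ) → Matrix (Fin n) (Fin n) ℝ} {x : Fin n → ℝ}
    (hP : ∀ i j, ContDiffAt ℝ ∞ (fun y => P y i j) x) :
    ContDiffAt ℝ ∞ (matrixFieldCLM P) x := by
  have h : matrixFieldCLM P = fun y => ∑ i, ∑ j, P y i j •
      (ContinuousLinearMap.proj (R := ℝ) (φ := fun _ : Fin n => ℝ) j).smulRight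
        (Pi.single i (1 : ℝ) : Fin n → ℝ) := by
    ext y v i
    simp [matrixFieldCLM_apply, Finset.sum_apply, Pi.single_apply]
  rw [h]
  exact ContDiffAt.sum fun i _ => ContDiffAt.sum fun j _ => (hP i j).smul contDiffAt_const

lemma contDiffAt_negDotCLM {Y : (Fin n → ℝ) → (Fin n → ℝ)} {x : Fin n → ℝ}
    (hY : ∀ i, ContDiffAt ℝ ∞ (fun y => Y y i) x) :
    ContDiffAt ℝ ∞ (negDotCLM Y) x :=
  (ContDiffAt.sum fun i _ => (hY i).smul contDiffAt_const).neg

lemma fderiv_matrixFieldCLM_apply {P : (Fin n → ℝ) → Matrix (Fin n) (Fin n) ℝ} {x : Fin n → ℝ}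
    (hP : ∀ i j, ContDiffAt ℝ ∞ (fun y => P y i j) x) (w v : Fin n → ℝ) (i : Fin n) :
    fderiv ℝ (matrixFieldCLM P) x w v i =
      ∑ j, ∑ l, w l * pd l (fun y => P y i j) x * v j := by
  have hd : (∞ : WithTop ℕ∞) ≠ 0 := by simp
  have h1 := (((contDiffAt_matrixFieldCLM hP).differentiableAt hd).hasFDerivAt.clm_apply
    (hasFDerivAt_const v x))
  have h2 := hasFDerivAt_pi'.1 h1 i
  have h3 : HasFDerivAt (fun y => ∑ j, P y i j * v j) _ x :=
    HasFDerivAt.fun_sum (u := Finset.univ) fun j _ =>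
      ((hP i j).differentiableAt hd).hasFDerivAt.mul_const (v j)
  have h4 := congrArg (fun L : (Fin n → ℝ) →L[ℝ] ℝ => L w) (h2.unique h3)
  simp only [fderiv_eq_sum_pd, FunLike.coe_sum, Finset.sum_apply,
    smul_apply, smul_eq_mul, Finset.mul_sum] at h4
  simpa [mul_comm] using h4

lemma fderiv_negDotCLM_apply {Y : (Fin n → ℝ) → (Fin n → ℝ)} {x : Fin n → ℝ}
    (hY : ∀ i, ContDiffAt ℝ ∞ (fun y => Y y i) x) (w u : Fin n → ℝ) :
    fderiv ℝ (negDotCLM Y) x w u = -∑ i, ∑ l, w l * pd l (fun y => Y y i) x * u i := by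
  have hd : (∞ : WithTop ℕ∞) ≠ 0 := by simp
  have h1 := (((contDiffAt_negDotCLM hY).differentiableAt hd).hasFDerivAt.clm_apply
    (hasFDerivAt_const u x))
  have h3 : HasFDerivAt (fun y => ∑ j, Y y j * u j) _ x :=
    HasFDerivAt.fun_sum (u := Finset.univ) fun j _ =>
      ((hY j).differentiableAt hd).hasFDerivAt.mul_const (u j)
  simp only [negDotCLM_apply] at h1
  have h4 := congrArg (fun L : (Fin n → ℝ) →L[ℝ] ℝ => L w) (h1.unique h3.fun_neg)
  simp only [fderiv_eq_sum_pd, FunLike.coe_sum, Finset.sum_apply,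
    neg_apply,
    smul_apply, smul_eq_mul, Finset.mul_sum] at h4
  simpa [mul_comm] using h4

lemma pd_neg (l : Fin n) (f : (Fin n → ℝ) → ℝ) (x : Fin n → ℝ) :
    pd l (fun y => -f y) x = -pd l f x := by
  simp [pd, fderiv_fun_neg]

/-- The Jacobi identity contracted with two constant covectors. -/
lemma IsPoissonMatrix.fderiv_symm {P : (Fin n → ℝ) → Matrix (Fin n) (Fin n) ℝ}
    {U : Set (Fin n → ℝ)} (hP : IsPoissonMatrix P U) (hU : IsOpen U) {x : Fin n → ℝ} (hx : x ∈ U)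
    (u v : Fin n → ℝ) :
    fderiv ℝ (matrixFieldCLM P) x (matrixFieldCLM P x u) v -
        fderiv ℝ (matrixFieldCLM P) x (matrixFieldCLM P x v) u =
      matrixFieldCLM P x fun l => ∑ j, ∑ k, v j * pd l (fun y => P y j k) x * u k := by
  have hs : ∀ i j, ContDiffAt ℝ ∞ (fun y => P y i j) x := fun i j =>
    (hP.1 i j).contDiffAt (hU.mem_nhds hx)
  have hskew : ∀ l i j, pd l (fun y => P y i j) x = -pd l (fun y => P y j i) x := by
    intro l i j
    rw [← pd_neg, pd, pd]
    congr 1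
    exact Filter.EventuallyEq.fderiv_eq
      ((hU.eventually_mem hx).mono fun y hy => hP.2.1 y hy i j)
  ext i
  have hJ : ∑ j, ∑ k, v j * u k * ∑ l, (P x l k * pd l (fun y => P y i j) x
      + P x l i * pd l (fun y => P y j k) x
      + P x l j * pd l (fun y => P y k i) x) = 0 := by
    simp [hP.2.2 x hx]
  rw [Pi.sub_apply, fderiv_matrixFieldCLM_apply hs, fderiv_matrixFieldCLM_apply hs]
  simp only [matrixFieldCLM_apply]
  have e1 : ∑ j, ∑ l, (∑ k, P x l k * u k) * pd l (fun y => P y i j) x * v j =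
      ∑ j, ∑ k, v j * u k * ∑ l, P x l k * pd l (fun y => P y i j) x := by
    refine Finset.sum_congr rfl fun j _ => ?_
    simp only [Finset.sum_mul, Finset.mul_sum]
    rw [Finset.sum_comm]
    exact Finset.sum_congr rfl fun k _ => Finset.sum_congr rfl fun l _ => by ring
  have e2 : ∑ k, ∑ l, (∑ j, P x l j * v j) * pd l (fun y => P y i k) x * u k =
      -∑ j, ∑ k, v j * u k * ∑ l, P x l j * pd l (fun y => P y k i) x := by
    rw [Finset.sum_comm (s := Finset.univ) (t := Finset.univ)
      (f := fun j k => v j * u k * ∑ l, P x l j * pd l (fun y => P y k i) x)]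
    rw [← Finset.sum_neg_distrib]
    refine Finset.sum_congr rfl fun k _ => ?_
    simp only [Finset.sum_mul, Finset.mul_sum, ← Finset.sum_neg_distrib]
    rw [Finset.sum_comm]
    refine Finset.sum_congr rfl fun j _ => Finset.sum_congr rfl fun l _ => ?_
    rw [hskew l i k]
    ring
  have e3 : ∑ l, P x i l * ∑ j, ∑ k, v j * pd l (fun y => P y j k) x * u k =
      -∑ j, ∑ k, v j * u k * ∑ l, P x l i * pd l (fun y => P y j k) x := by
    simp only [Finset.mul_sum, ← Finset.sum_neg_distrib]
    rw [Finset.sum_comm]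
    refine Finset.sum_congr rfl fun j _ => ?_
    rw [Finset.sum_comm]
    refine Finset.sum_congr rfl fun k _ => Finset.sum_congr rfl fun l _ => ?_
    rw [hP.2.1 x hx i l]
    ring
  rw [e1, e2, e3]
  simp only [Finset.sum_add_distrib, mul_add] at hJ
  linarith

/-- The equation `L_Y P = 0` contracted with two constant covectors. -/
lemma fderiv_negDotCLM_symm_of_lieDer_eq_zero {P : (Fin n → ℝ) → Matrix (Fin n) (Fin n) ℝ}
    {Y : (Fin n → ℝ) → (Fin n → ℝ)} {x : Fin n → ℝ}
    (hs : ∀ i, ContDiffAt ℝ ∞ (fun y => Y y i) x) (hskew : ∀ i j, P x i j = -P x j i)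
    (hY : lieDer Y P x = 0) (u v : Fin n → ℝ) :
    fderiv ℝ (negDotCLM Y) x (matrixFieldCLM P x u) v -
        fderiv ℝ (negDotCLM Y) x (matrixFieldCLM P x v) u =
      negDotCLM Y x fun l => ∑ j, ∑ k, v j * pd l (fun y => P y j k) x * u k := by
  have hL : ∑ j, ∑ k, v j * u k * ∑ l, (Y x l * pd l (fun y => P y j k) x
      - P x l k * pd l (fun y => Y y j) x - P x j l * pd l (fun y => Y y k) x) = 0 := by
    have : ∀ j k, ∑ l, (Y x l * pd l (fun y => P y j k) x
      - P x l k * pd l (fun y => Y y j) x - P x j l * pd l (fun y => Y y k) x) = 0 :=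
      fun j k => congrFun (congrFun hY j) k
    simp [this]
  rw [fderiv_negDotCLM_apply hs, fderiv_negDotCLM_apply hs, negDotCLM_apply]
  simp only [matrixFieldCLM_apply]
  have e1 : ∑ j, ∑ l, (∑ k, P x l k * u k) * pd l (fun y => Y y j) x * v j =
      ∑ j, ∑ k, v j * u k * ∑ l, P x l k * pd l (fun y => Y y j) x := by
    refine Finset.sum_congr rfl fun j _ => ?_
    simp only [Finset.sum_mul, Finset.mul_sum]
    rw [Finset.sum_comm]
    exact Finset.sum_congr rfl fun k _ => Finset.sum_congr rfl fun l _ => by ring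
  have e2 : ∑ k, ∑ l, (∑ j, P x l j * v j) * pd l (fun y => Y y k) x * u k =
      -∑ j, ∑ k, v j * u k * ∑ l, P x j l * pd l (fun y => Y y k) x := by
    rw [Finset.sum_comm (s := Finset.univ) (t := Finset.univ)
      (f := fun j k => v j * u k * ∑ l, P x j l * pd l (fun y => Y y k) x)]
    rw [← Finset.sum_neg_distrib]
    refine Finset.sum_congr rfl fun k _ => ?_
    simp only [Finset.sum_mul, Finset.mul_sum, ← Finset.sum_neg_distrib]
    rw [Finset.sum_comm]
    refine Finset.sum_congr rfl fun j _ => Finset.sum_congr rfl fun l _ => ?_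
    rw [hskew l j]
    ring
  have e3 : ∑ l, Y x l * ∑ j, ∑ k, v j * pd l (fun y => P y j k) x * u k =
      ∑ j, ∑ k, v j * u k * ∑ l, Y x l * pd l (fun y => P y j k) x := by
    simp only [Finset.mul_sum]
    rw [Finset.sum_comm]
    refine Finset.sum_congr rfl fun j _ => ?_
    rw [Finset.sum_comm]
    refine Finset.sum_congr rfl fun k _ => Finset.sum_congr rfl fun l _ => ?_
    ring
  rw [e1, e2, e3]
  simp only [Finset.sum_sub_distrib, mul_sub] at hL
  linarith

lemma negDotCLM_eq_zero_of_skew {P : (Fin n → ℝ) → Matrix (Fin n) (Fin n) ℝ}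
    {Y : (Fin n → ℝ) → (Fin n → ℝ)} {x : Fin n → ℝ} (hskew : ∀ i j, P x i j = -P x j i)
    (hY : ∃ v, (P x).mulVec v = Y x) {u : Fin n → ℝ} (hu : matrixFieldCLM P x u = 0) :
    negDotCLM Y x u = 0 := by
  obtain ⟨v, hv⟩ := hY
  have h1 : ∀ j, ∑ i, P x j i * u i = 0 := fun j => by
    rw [← matrixFieldCLM_apply, hu, Pi.zero_apply]
  have h2 : ∀ i, Y x i = ∑ j, P x i j * v j := fun i => by rw [← hv]; rfl
  rw [negDotCLM_apply]
  simp only [h2, Finset.sum_mul]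
  rw [Finset.sum_comm, neg_eq_zero]
  refine Finset.sum_eq_zero fun j _ => ?_
  calc ∑ i, P x i j * v j * u i = -v j * ∑ i, P x j i * u i := by
        rw [Finset.mul_sum]
        exact Finset.sum_congr rfl fun i _ => by rw [hskew i j]; ring
    _ = 0 := by rw [h1, mul_zero]

end Coordinates

/-- A Poisson vector field which is tangent to the symplectic leaves is Hamiltonian in a
neighborhood of every point where the rank of the Poisson structure is maximal
(Lemma 3.7 of the paper, in local coordinates). -/
theorem poisson_vector_field_tangent_is_locally_hamiltonian {n r : ℕ}
    (U : Set (Fin n → ℝ)) (hU : IsOpen U)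
    (P : (Fin n → ℝ) → Matrix (Fin n) (Fin n) ℝ) (hP : IsPoissonMatrix P U)
    (hrk : ∀ x ∈ U, (P x).rank ≤ 2 * r)
    (Y : (Fin n → ℝ) → (Fin n → ℝ)) (hYs : ∀ i, ContDiffOn ℝ (⊤ : ℕ∞) (fun x => Y x i) U)
    -- (i) `Y` is a Poisson vector field: `L_Y π = 0` on `U`
    (hYP : ∀ x ∈ U, lieDer Y P x = 0)
    -- (ii) `Y` is tangent to the symplectic leaves: `Y(x)` lies in the column space of `π(x)`
    (hYtan : ∀ x ∈ U, ∃ v : Fin n → ℝ, (P x).mulVec v = Y x) :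
    ∀ m ∈ U, (P m).rank = 2 * r →
      ∃ V : Set (Fin n → ℝ), IsOpen V ∧ m ∈ V ∧ V ⊆ U ∧
        ∃ h : (Fin n → ℝ) → ℝ, ContDiffOn ℝ (⊤ : ℕ∞) h V ∧
          ∀ x ∈ V, ∀ i, Y x i = ∑ j, P x i j * pd j h x := by
  intro m hm hrm
  have hP' : ∀ x ∈ U, ∀ i j, ContDiffAt ℝ ∞ (fun y => P y i j) x := fun x hx i j =>
    (hP.1 i j).contDiffAt (hU.mem_nhds hx)
  have hY' : ∀ x ∈ U, ∀ i, ContDiffAt ℝ ∞ (fun y => Y y i) x := fun x hx i =>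
    (hYs i).contDiffAt (hU.mem_nhds hx)
  have hUm := hU.eventually_mem hm
  obtain ⟨h, hh⟩ := exists_fderiv_comp_eq (A := matrixFieldCLM P) (b := negDotCLM Y) (m := m)
    (hUm.mono fun x hx => contDiffAt_matrixFieldCLM (hP' x hx))
    (hUm.mono fun x hx => contDiffAt_negDotCLM (hY' x hx))
    (hUm.mono fun x hx => (hrk x hx).trans hrm.ge)
    (hUm.mono fun x hx u hu => negDotCLM_eq_zero_of_skew (hP.2.1 x hx) (hYtan x hx) hu)
    (hUm.mono fun x hx u v => ⟨_, hP.fderiv_symm hU hx u v,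
      fderiv_negDotCLM_symm_of_lieDer_eq_zero (hY' x hx) (hP.2.1 x hx) (hYP x hx) u v⟩)
  obtain ⟨V, hV, hVo, hmV⟩ := eventually_nhds_iff.1 (hh.and hUm)
  refine ⟨V, hVo, hmV, fun x hx => (hV x hx).2, h,
    fun x hx => (hV x hx).1.1.contDiffWithinAt, fun x hx i => ?_⟩
  have h1 := (hV x hx).1.2 (Pi.single i 1)
  rw [fderiv_eq_sum_pd, negDotCLM_apply] at h1
  simp only [matrixFieldCLM_apply, Pi.single_apply, mul_ite, mul_one, mul_zero,
    Finset.sum_ite_eq', Finset.mem_univ, if_true] at h1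
  rw [← neg_neg (Y x i), ← h1, ← Finset.sum_neg_distrib]
  refine Finset.sum_congr rfl fun j _ => ?_
  rw [hP.2.1 x (hV x hx).2 i j]
  ring
end
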